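/- arXiv:2102.10628 — 10 statements merged into one kernel-verified Lean document; each statement's English description precedes it below -/
import Mathlib

section
/- Let Ω be a set, let K : Ω × Ω → ℝ be a positive-semidefinite kernel that is bounded (say sup_{x∈Ω} K(x,x) ≤ C_K < ∞ and sup_{x,y∈Ω} |K(x,y)| < ∞), and let (x_n)_{n=1}^∞ be a sequence in Ω such that for every pair of indices n ≠ m one has lim_{ℓ→∞} |K(x_{ℓ+n}, x_{ℓ+m})| = 0. Suppose f : Ω → ℝ and α > 0 are such that either f(x_n) ≥ α for all sufficiently large n, or f(x_n) ≤ −α for all sufficiently large n. Then for every c > 0 the function R(x,y) = K(x,y) − c² f(x) f(y) is NOT a positive-semidefinite kernel on Ω (equivalently, by Aronszajn's characterisation, f is not an element of the reproducing kernel Hilbert space H_K(Ω)). -/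
/-- `K` is a positive-semidefinite kernel on `Ω`: for every `N ≥ 1`, all coefficients
`a₁, …, a_N ∈ ℝ` and all points `x₁, …, x_N ∈ Ω`, the quadratic form is nonnegative. -/
def IsPSDKernel {Ω : Type*} (K : Ω → Ω → ℝ) : Prop :=
  ∀ (N : ℕ) (a : Fin N → ℝ) (x : Fin N → Ω),
    0 ≤ ∑ n : Fin N, ∑ m : Fin N, a n * a m * K (x n) (x m)

/-- If `K` is a bounded PSD kernel on a set `Ω`, `(xₙ)` is a sequence in `Ω`
such that `|K(x_{ℓ+n}, x_{ℓ+m})| → 0` as `ℓ → ∞` for all `n ≠ m`, and `f` is eventually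
bounded away from zero (with fixed sign) along the sequence, then for every `c > 0` the
function `R(x,y) = K(x,y) - c² f(x) f(y)` is not a PSD kernel on `Ω`
(equivalently, `f ∉ H_K(Ω)`). -/
theorem stmt0_not_in_rkhs_of_decay
    {Ω : Type*} (K : Ω → Ω → ℝ)
    (hPSD : IsPSDKernel K)
    (C_K : ℝ) (hdiag : ∀ x : Ω, K x x ≤ C_K)
    (hbdd : ∃ B : ℝ, ∀ x y : Ω, |K x y| ≤ B)
    (x : ℕ → Ω)
    (hdecay : ∀ n m : ℕ, n ≠ m →
      Filter.Tendsto (fun ℓ : ℕ => |K (x (ℓ + n)) (x (ℓ + m))|) Filter.atTop (nhds 0))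
    (f : Ω → ℝ) (α : ℝ) (hα : 0 < α)
    (hf : (∀ᶠ n in Filter.atTop, α ≤ f (x n)) ∨ (∀ᶠ n in Filter.atTop, f (x n) ≤ -α)) :
    ∀ c : ℝ, 0 < c →
      ¬ IsPSDKernel (fun p q : Ω => K p q - c ^ 2 * f p * f q) := by
  intro c hc hR
  have hδ : 0 < c ^ 2 * α ^ 2 := by positivity
  obtain ⟨N, hN⟩ := exists_nat_gt (max 0 (C_K / (c ^ 2 * α ^ 2 / 2)))
  have hN0 : (0 : ℝ) < N := (le_max_left _ _).trans_lt hN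
  have hNC : C_K < N * (c ^ 2 * α ^ 2 / 2) :=
    (div_lt_iff₀ (by positivity)).1 ((le_max_right _ _).trans_lt hN)
  have hff : ∀ᶠ ℓ in Filter.atTop, ∀ i j : ℕ,
      α ^ 2 ≤ f (x (ℓ + i)) * f (x (ℓ + j)) := by
    rcases hf with hf | hf <;> obtain ⟨M, hM⟩ := Filter.eventually_atTop.1 hf <;>
      filter_upwards [Filter.eventually_ge_atTop M] with ℓ hℓ i j <;>
      have hi := hM (ℓ + i) (by omega) <;>
      have hj := hM (ℓ + j) (by omega) <;>
      nlinarith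
  have hK : ∀ᶠ ℓ in Filter.atTop, ∀ i j : Fin N, i ≠ j →
      K (x (ℓ + i)) (x (ℓ + j)) < c ^ 2 * α ^ 2 / 2 := by
    simp only [Filter.eventually_all]
    intro i j hij
    filter_upwards [(hdecay i j (Fin.val_ne_of_ne hij)).eventually_lt_const (half_pos hδ)]
      with ℓ hℓ
    exact (le_abs_self _).trans_lt hℓ
  obtain ⟨ℓ, hffℓ, hKℓ⟩ := (hff.and hK).exists
  have hterm : ∀ i j : Fin N,
      K (x (ℓ + i)) (x (ℓ + j)) - c ^ 2 * f (x (ℓ + i)) * f (x (ℓ + j)) ≤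
        (if i = j then C_K else 0) - c ^ 2 * α ^ 2 / 2 := by
    intro i j
    have hmul := mul_le_mul_of_nonneg_left (hffℓ i j) (sq_nonneg c)
    split_ifs with hij
    · subst hij
      linarith [hdiag (x (ℓ + i))]
    · linarith [hKℓ i j hij]
  have hle := (hR N (fun _ => 1) (fun i => x (ℓ + i))).trans
    (Finset.sum_le_sum fun i _ => Finset.sum_le_sum fun j _ => by
      simpa only [one_mul] using hterm i j)
  simp only [Finset.sum_sub_distrib, Finset.sum_ite_eq, Finset.mem_univ, if_true,
    Finset.sum_const, Finset.card_univ, Fintype.card_fin, nsmul_eq_mul] at hle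
  nlinarith [mul_lt_mul_of_pos_left hNC hN0]
end

section
/- Let K : ℝ × ℝ → ℝ be a positive-semidefinite kernel such that every member of H_K(ℝ) is analytic; concretely, assume that every function g : ℝ → ℝ for which there exists c > 0 making (x,y) ↦ K(x,y) − c² g(x) g(y) positive semidefinite on ℝ is analytic on ℝ. Let Ω ⊆ ℝ be a set having an accumulation point, and let f : ℝ → ℝ be analytic. Then there exists c > 0 such that (x,y) ↦ K(x,y) − c² f(x) f(y) is positive semidefinite on ℝ (i.e., f ∈ H_K(ℝ)) if and only if there exists a function g : ℝ → ℝ with g ∈ H_K(ℝ) (in the same sense) such that g(x) = f(x) for all x ∈ Ω. -/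
/-- `f` belongs to the RKHS `H_K` of `K`, via Aronszajn's characterisation:
there is `c > 0` such that `(x,y) ↦ K(x,y) - c² f(x) f(y)` is positive semidefinite. -/
def MemRKHS {Ω : Type*} (K : Ω → Ω → ℝ) (f : Ω → ℝ) : Prop :=
  ∃ c : ℝ, 0 < c ∧ IsPSDKernel (fun p q : Ω => K p q - c ^ 2 * f p * f q)

/-- Let `K` be a PSD kernel on `ℝ` whose RKHS consists of analytic
functions, let `Ω ⊆ ℝ` have an accumulation point, and let `f : ℝ → ℝ` be analytic.
Then `f ∈ H_K(ℝ)` if and only if there is `g ∈ H_K(ℝ)` with `g = f` on `Ω`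
(i.e. `f|_Ω ∈ H_K(Ω)`). -/
theorem stmt1_analytic_restriction_iff
    (K : ℝ → ℝ → ℝ) (hPSD : IsPSDKernel K)
    (hanalytic : ∀ g : ℝ → ℝ, MemRKHS K g → ∀ x : ℝ, AnalyticAt ℝ g x)
    (Ω : Set ℝ) (hΩ : ∃ p : ℝ, AccPt p (Filter.principal Ω))
    (f : ℝ → ℝ) (hf : ∀ x : ℝ, AnalyticAt ℝ f x) :
    MemRKHS K f ↔ ∃ g : ℝ → ℝ, MemRKHS K g ∧ ∀ x ∈ Ω, g x = f x := by
  refine ⟨fun h => ⟨f, h, fun _ _ => rfl⟩, ?_⟩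
  rintro ⟨g, hg, hgf⟩
  obtain ⟨p, hp⟩ := hΩ
  have hfreq : ∃ᶠ z in nhdsWithin p {p}ᶜ, g z = f z :=
    (accPt_iff_frequently_nhdsNE.mp hp).mono hgf
  have hgf_eq : g = f :=
    AnalyticOnNhd.eq_of_frequently_eq (fun x _ => hanalytic g hg x) (fun x _ => hf x) hfreq
  exact hgf_eq ▸ hg
end

section
/- Let K : ℝ × ℝ → ℝ be a bounded positive-semidefinite kernel such that every function g : ℝ → ℝ for which there exists c > 0 making (x,y) ↦ K(x,y) − c² g(x) g(y) positive semidefinite on ℝ is analytic on ℝ. Let Ω ⊆ ℝ have an accumulation point, and let (x_n)_{n=1}^∞ be a sequence in Ω such that lim_{ℓ→∞} |K(x_{ℓ+n}, x_{ℓ+m})| = 0 for every pair n ≠ m. Let f : Ω → ℝ, and suppose there exist an analytic function f_e : ℝ → ℝ with f_e|_Ω = f and α > 0 such that either f_e(x_n) ≥ α for all sufficiently large n or f_e(x_n) ≤ −α for all sufficiently large n. Then f ∉ H_K(Ω), i.e., there exists no function g : ℝ → ℝ such that (x,y) ↦ K(x,y) − c² g(x) g(y) is positive semidefinite on ℝ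 for some c > 0 and g(x) = f(x) for all x ∈ Ω. -/
open Filter Topology

theorem MemRKHS.neg {X : Type*} {K : X → X → ℝ} {g : X → ℝ} (hg : MemRKHS K g) :
    MemRKHS K (fun p => -g p) := by
  obtain ⟨c, hc, h⟩ := hg
  refine ⟨c, hc, ?_⟩
  convert h using 3
  ring

theorem MemRKHS.exists_sq_sum_le {X : Type*} {K : X → X → ℝ} {g : X → ℝ} (hg : MemRKHS K g) :
    ∃ c : ℝ, 0 < c ∧ ∀ (N : ℕ) (y : Fin N → X),
      c ^ 2 * (∑ n, g (y n)) ^ 2 ≤ ∑ n, ∑ m, K (y n) (y m) := by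
  obtain ⟨c, hc, h⟩ := hg
  refine ⟨c, hc, fun N y => ?_⟩
  have h1 := h N (fun _ => 1) y
  have h2 : ∑ n, ∑ m, c ^ 2 * g (y n) * g (y m) = c ^ 2 * (∑ n, g (y n)) ^ 2 := by
    rw [sq (∑ n, g (y n)), Finset.sum_mul_sum, Finset.mul_sum]
    simp_rw [Finset.mul_sum, mul_assoc]
  simp only [one_mul, Finset.sum_sub_distrib] at h1
  linarith

/-- A function that stays above a positive constant along a sequence with asymptotically
vanishing off-diagonal kernel values is not in the RKHS of a bounded kernel. -/
theorem not_memRKHS_of_eventually_le {X : Type*} {K : X → X → ℝ} {B : ℝ}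
    (hB : ∀ p q, |K p q| ≤ B) {x : ℕ → X}
    (hdecay : ∀ n m : ℕ, n ≠ m → Tendsto (fun ℓ : ℕ => |K (x (ℓ + n)) (x (ℓ + m))|) atTop (𝓝 0))
    {g : X → ℝ} {α : ℝ} (hα : 0 < α) (hg : ∀ᶠ n in atTop, α ≤ g (x n)) : ¬ MemRKHS K g := by
  intro hmem
  obtain ⟨c, hc, h⟩ := hmem.exists_sq_sum_le
  have key (N : ℕ) : c ^ 2 * (N * α) ^ 2 ≤ N * B := by
    have hlim : Tendsto (fun ℓ : ℕ => ∑ n : Fin N, ∑ m : Fin N,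
        if n = m then B else |K (x (ℓ + n)) (x (ℓ + m))|) atTop
        (𝓝 (∑ n : Fin N, ∑ m : Fin N, if n = m then B else 0)) := by
      refine tendsto_finsetSum _ fun n _ => tendsto_finsetSum _ fun m _ => ?_
      split_ifs with hnm
      · exact tendsto_const_nhds
      · exact hdecay n m (Fin.val_ne_of_ne hnm)
    have hsum : (∑ n : Fin N, ∑ m : Fin N, if n = m then B else 0) = N * B := by simp
    rw [hsum] at hlim
    refine ge_of_tendsto hlim ?_
    obtain ⟨L, hL⟩ := eventually_atTop.1 hg
    filter_upwards [eventually_ge_atTop L] with ℓ hℓ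
    have hlow : N * α ≤ ∑ n : Fin N, g (x (ℓ + n)) := by
      calc N * α = ∑ _n : Fin N, α := by simp
        _ ≤ _ := Finset.sum_le_sum fun n _ => hL _ (by omega)
    calc c ^ 2 * (N * α) ^ 2 ≤ c ^ 2 * (∑ n : Fin N, g (x (ℓ + n))) ^ 2 := by gcongr
      _ ≤ ∑ n : Fin N, ∑ m : Fin N, K (x (ℓ + n)) (x (ℓ + m)) := h N fun n => x (ℓ + n)
      _ ≤ _ := Finset.sum_le_sum fun n _ => Finset.sum_le_sum fun m _ => by
        split_ifs
        · exact (le_abs_self _).trans (hB _ _)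
        · exact le_abs_self _
  have hpos : 0 < c ^ 2 * α ^ 2 := by positivity
  obtain ⟨N, hN⟩ := exists_nat_gt (B / (c ^ 2 * α ^ 2))
  rw [div_lt_iff₀ hpos] at hN
  have hB0 : 0 ≤ B := (abs_nonneg _).trans (hB (x 0) (x 0))
  have hN0 : (0 : ℝ) < N := by
    by_contra! hle
    nlinarith
  nlinarith [key N, mul_lt_mul_of_pos_left hN hN0]

/-- Let `K` be a bounded PSD kernel on `ℝ` whose RKHS consists of
analytic functions, let `Ω ⊆ ℝ` have an accumulation point, and let `(xₙ)` be a
sequence in `Ω` with `|K(x_{ℓ+n}, x_{ℓ+m})| → 0` as `ℓ → ∞` for `n ≠ m`.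
If `f : Ω → ℝ` has an analytic extension `f_e : ℝ → ℝ` which is eventually bounded away
from zero (with fixed sign) along `(xₙ)`, then `f ∉ H_K(Ω)`: no `g ∈ H_K(ℝ)` agrees
with `f` on `Ω`. -/
theorem stmt2_not_in_rkhs_on_subset
    (K : ℝ → ℝ → ℝ) (hPSD : IsPSDKernel K)
    (hbdd : ∃ B : ℝ, ∀ x y : ℝ, |K x y| ≤ B)
    (hanalytic : ∀ g : ℝ → ℝ, MemRKHS K g → ∀ x : ℝ, AnalyticAt ℝ g x)
    (Ω : Set ℝ) (hΩ : ∃ p : ℝ, AccPt p (Filter.principal Ω))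
    (x : ℕ → ℝ) (hxΩ : ∀ n, x n ∈ Ω)
    (hdecay : ∀ n m : ℕ, n ≠ m →
      Filter.Tendsto (fun ℓ : ℕ => |K (x (ℓ + n)) (x (ℓ + m))|) Filter.atTop (nhds 0))
    (f : Ω → ℝ)
    (f_e : ℝ → ℝ) (hfe_analytic : ∀ v : ℝ, AnalyticAt ℝ f_e v)
    (hext : ∀ v : Ω, f_e v = f v)
    (α : ℝ) (hα : 0 < α)
    (hsign : (∀ᶠ n in Filter.atTop, α ≤ f_e (x n)) ∨
             (∀ᶠ n in Filter.atTop, f_e (x n) ≤ -α)) :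
    ¬ ∃ g : ℝ → ℝ, MemRKHS K g ∧ ∀ v : Ω, g v = f v := by
  rintro ⟨g, hg, hgf⟩
  obtain ⟨B, hB⟩ := hbdd
  have hgx (n : ℕ) : g (x n) = f_e (x n) := (hgf ⟨x n, hxΩ n⟩).trans (hext ⟨x n, hxΩ n⟩).symm
  rcases hsign with h | h
  · exact not_memRKHS_of_eventually_le hB hdecay hα (by simpa only [hgx] using h) hg
  · refine not_memRKHS_of_eventually_le hB hdecay hα ?_ hg.neg
    filter_upwards [h] with n hn
    rw [hgx]
    linarith
end

section
/- Let φ : [0,∞) → ℝ satisfy φ ≥ 0 and lim_{r→∞} φ(r) = 0, and suppose K(x,y) = φ((x−y)²) defines a positive-semidefinite kernel on ℝ. Let f : ℝ → ℝ be such that there exists R ∈ ℝ with either (a) f does not change sign on [R,∞) and liminf_{x→∞} |f(x)| > 0, or (b) f does not change sign on (−∞,R] and liminf_{x→−∞} |f(x)| > 0. Then for every c > 0 the function (x,y) ↦ K(x,y) − c² f(x) f(y) is NOT positive semidefinite on ℝ (i.e., f ∉ H_K(ℝ)). -/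
/-- A real function bounded away from zero in the limit inferior is eventually bounded below in
absolute value by a positive real. -/
lemma exists_pos_eventually_le_abs_of_liminf_pos {f : ℝ → ℝ} {l : Filter ℝ}
    (h : (0 : EReal) < Filter.liminf (fun x : ℝ => ((|f x| : ℝ) : EReal)) l) :
    ∃ δ : ℝ, 0 < δ ∧ ∀ᶠ x in l, δ ≤ |f x| := by
  obtain ⟨δ, hδ0, hδ⟩ := EReal.lt_iff_exists_real_btwn.mp h
  refine ⟨δ, by exact_mod_cast hδ0, ?_⟩
  filter_upwards [Filter.eventually_lt_of_lt_liminf hδ] with x hx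
  exact_mod_cast hx.le

/-- If `f` is nonnegative or nonpositive on a set and `|f| ≥ δ` there, then products of values
of `f` on this set are at least `δ²`. -/
lemma sq_le_mul_of_sign_of_le_abs {f : ℝ → ℝ} {S : Set ℝ} {δ : ℝ} (hδ : 0 < δ)
    (hsign : (∀ x ∈ S, 0 ≤ f x) ∨ (∀ x ∈ S, f x ≤ 0)) (habs : ∀ x ∈ S, δ ≤ |f x|)
    {p q : ℝ} (hp : p ∈ S) (hq : q ∈ S) : δ ^ 2 ≤ f p * f q := by
  have hpq : f p * f q = |f p| * |f q| := by
    rcases hsign with h | h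
    · rw [abs_of_nonneg (h p hp), abs_of_nonneg (h q hq)]
    · rw [abs_of_nonpos (h p hp), abs_of_nonpos (h q hq), neg_mul_neg]
  rw [hpq, sq]
  exact mul_le_mul (habs p hp) (habs q hq) hδ.le (abs_nonneg _)

/-- A kernel `φ((x-y)²) - c² f(x) f(y)` with `φ` decaying at infinity is not positive semidefinite
when products of values of `f` along a half-line (in direction `u`) are bounded below. -/
lemma not_isPSDKernel_of_sq_le_mul {φ f : ℝ → ℝ} {c δ M u : ℝ}
    (hφ_decay : Filter.Tendsto φ Filter.atTop (nhds 0)) (hc : 0 < c) (hδ : 0 < δ)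
    (hu : u ^ 2 = 1) (hf : ∀ p q : ℝ, M ≤ p → M ≤ q → δ ^ 2 ≤ f (u * p) * f (u * q)) :
    ¬ IsPSDKernel (fun p q : ℝ => φ ((p - q) ^ 2) - c ^ 2 * f p * f q) := by
  intro hpsd
  obtain ⟨ε, hε⟩ : ∃ ε : ℝ, ε = c ^ 2 * δ ^ 2 / 2 := ⟨_, rfl⟩
  have hε0 : 0 < ε := by rw [hε]; positivity
  obtain ⟨B, hB⟩ := Filter.eventually_atTop.mp (hφ_decay.eventually (gt_mem_nhds hε0))
  obtain ⟨L, hBL, hL⟩ : ∃ L : ℝ, B ≤ L ∧ 1 ≤ L := ⟨max B 1, le_max_left _ _, le_max_right _ _⟩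
  obtain ⟨N, hN⟩ := exists_nat_gt (max 0 (φ 0 / ε))
  have hN0 : (0 : ℝ) < N := (le_max_left _ _).trans_lt hN
  have hNφ : φ 0 < N * ε := (div_lt_iff₀ hε0).mp ((le_max_right _ _).trans_lt hN)
  have hterm : ∀ n m : Fin N,
      (1 : ℝ) * 1 * (φ ((u * (M + L * (n : ℕ)) - u * (M + L * (m : ℕ))) ^ 2) -
        c ^ 2 * f (u * (M + L * (n : ℕ))) * f (u * (M + L * (m : ℕ)))) ≤
      (if n = m then φ 0 else 0) - ε := by
    intro n m
    have hff := hf (M + L * (n : ℕ)) (M + L * (m : ℕ))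
      (le_add_of_nonneg_right (by positivity)) (le_add_of_nonneg_right (by positivity))
    have hcff := mul_le_mul_of_nonneg_left hff (sq_nonneg c)
    split_ifs with hnm
    · subst hnm
      simp only [sub_self, ne_eq, OfNat.ofNat_ne_zero, not_false_eq_true, zero_pow]
      linarith
    · have hdist : (1 : ℝ) ≤ (((n : ℕ) : ℝ) - ((m : ℕ) : ℝ)) ^ 2 := by
        have hne : ((n : ℕ) : ℤ) - ((m : ℕ) : ℤ) ≠ 0 := by
          intro h
          exact hnm (Fin.ext (by lia))
        exact_mod_cast Int.add_one_le_iff.mpr (pow_pos (abs_pos.mpr hne) 2 |>.trans_eq (sq_abs _))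
      have hlarge : B ≤ (u * (M + L * (n : ℕ)) - u * (M + L * (m : ℕ))) ^ 2 := by
        have heq : (u * (M + L * (n : ℕ)) - u * (M + L * (m : ℕ))) ^ 2 =
            u ^ 2 * (L ^ 2 * (((n : ℕ) : ℝ) - ((m : ℕ) : ℝ)) ^ 2) := by ring
        rw [heq, hu]
        nlinarith
      have := hB _ hlarge
      linarith
  have hsum := (hpsd N (fun _ => 1) (fun n => u * (M + L * (n : ℕ)))).trans
    (Finset.sum_le_sum fun n _ => Finset.sum_le_sum fun m _ => hterm n m)
  simp only [Finset.sum_sub_distrib, Finset.sum_ite_eq, Finset.mem_univ, if_true,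
    Finset.sum_const, Finset.card_univ, Fintype.card_fin, nsmul_eq_mul] at hsum
  nlinarith

/-- Let `φ ≥ 0` on `[0,∞)` with `φ(r) → 0` as `r → ∞`, and suppose
`K(x,y) = φ((x-y)²)` is a PSD kernel on `ℝ`. If `f` does not change sign on `[R,∞)` and
`liminf_{x→∞} |f(x)| > 0`, or `f` does not change sign on `(-∞,R]` and
`liminf_{x→-∞} |f(x)| > 0`, then `f ∉ H_K(ℝ)`: for every `c > 0` the function
`(x,y) ↦ K(x,y) - c² f(x) f(y)` is not positive semidefinite. -/
theorem stmt3_translation_invariant_not_in_rkhs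
    (φ : ℝ → ℝ) (hφ_nonneg : ∀ r : ℝ, 0 ≤ r → 0 ≤ φ r)
    (hφ_decay : Filter.Tendsto φ Filter.atTop (nhds 0))
    (K : ℝ → ℝ → ℝ) (hK : ∀ x y : ℝ, K x y = φ ((x - y) ^ 2))
    (hPSD : IsPSDKernel K)
    (f : ℝ → ℝ)
    (hf : ∃ R : ℝ,
      (((∀ x : ℝ, R ≤ x → 0 ≤ f x) ∨ (∀ x : ℝ, R ≤ x → f x ≤ 0)) ∧
        (0 : EReal) < Filter.liminf (fun x : ℝ => ((|f x| : ℝ) : EReal)) Filter.atTop) ∨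
      (((∀ x : ℝ, x ≤ R → 0 ≤ f x) ∨ (∀ x : ℝ, x ≤ R → f x ≤ 0)) ∧
        (0 : EReal) < Filter.liminf (fun x : ℝ => ((|f x| : ℝ) : EReal)) Filter.atBot)) :
    ∀ c : ℝ, 0 < c →
      ¬ IsPSDKernel (fun p q : ℝ => K p q - c ^ 2 * f p * f q) := by
  intro c hc
  obtain rfl : K = fun x y => φ ((x - y) ^ 2) := funext₂ hK
  obtain ⟨R, ⟨hsign, hlim⟩ | ⟨hsign, hlim⟩⟩ := hf
  · obtain ⟨δ, hδ, hev⟩ := exists_pos_eventually_le_abs_of_liminf_pos hlim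
    obtain ⟨M, hM⟩ := Filter.eventually_atTop.mp hev
    refine not_isPSDKernel_of_sq_le_mul (M := max M R) (u := 1) hφ_decay hc hδ (by norm_num) ?_
    intro p q hp hq
    refine sq_le_mul_of_sign_of_le_abs (S := Set.Ici (max M R)) hδ
      (hsign.imp (fun h x hx => h x ((le_max_right _ _).trans hx))
        (fun h x hx => h x ((le_max_right _ _).trans hx)))
      (fun x hx => hM x ((le_max_left _ _).trans hx)) ?_ ?_ <;>
    rwa [one_mul, Set.mem_Ici]
  · obtain ⟨δ, hδ, hev⟩ := exists_pos_eventually_le_abs_of_liminf_pos hlim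
    obtain ⟨M, hM⟩ := Filter.eventually_atBot.mp hev
    refine not_isPSDKernel_of_sq_le_mul (M := -min M R) (u := -1) hφ_decay hc hδ (by norm_num) ?_
    intro p q hp hq
    refine sq_le_mul_of_sign_of_le_abs (S := Set.Iic (min M R)) hδ
      (hsign.imp (fun h x hx => h x (le_trans hx (min_le_right _ _)))
        (fun h x hx => h x (le_trans hx (min_le_right _ _))))
      (fun x hx => hM x (le_trans hx (min_le_left _ _))) ?_ ?_ <;>
    · rw [Set.mem_Iic]
      linarith
end

section
/- Let φ : ℝ → ℝ be analytic on ℝ and suppose K(x,y) = φ((x−y)²) defines a positive-semidefinite kernel on ℝ. Then every element of H_K(ℝ) is analytic on ℝ; concretely: if f : ℝ → ℝ is such that there exists c > 0 for which (x,y) ↦ K(x,y) − c² f(x) f(y) is positive semidefinite on ℝ, then f is analytic on ℝ. -/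
section

open Filter Topology Set
open scoped Nat ContDiff

/-- The functional `∑ aᵢ δ_{xᵢ} ↦ ∑ aᵢ f (xᵢ)` is dominated by the quadratic form of the
translation-invariant kernel `k (x - y)`. -/
def IsDominatedBy (k f : ℝ → ℝ) : Prop :=
  ∀ (ι : Type) [Fintype ι] (a x : ι → ℝ),
    (∑ i, a i * f (x i)) ^ 2 ≤ ∑ i, ∑ j, a i * a j * k (x i - x j)

lemma IsPSDKernel.isDominatedBy {k f : ℝ → ℝ}
    (h : IsPSDKernel fun p q : ℝ => k (p - q) - f p * f q) : IsDominatedBy k f := by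
  intro ι _ a x
  let e := (Fintype.equivFin ι).symm
  have key := h (Fintype.card ι) (a ∘ e) (x ∘ e)
  have h1 : ∑ n, ∑ m, (a ∘ e) n * (a ∘ e) m *
      (k ((x ∘ e) n - (x ∘ e) m) - f ((x ∘ e) n) * f ((x ∘ e) m)) =
      ∑ i, ∑ j, a i * a j * (k (x i - x j) - f (x i) * f (x j)) := by
    rw [← e.sum_comp]
    refine Finset.sum_congr rfl fun n _ => ?_
    rw [← e.sum_comp]
    rfl
  have h2 : ∑ i, ∑ j, a i * a j * (k (x i - x j) - f (x i) * f (x j)) =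
      (∑ i, ∑ j, a i * a j * k (x i - x j)) - (∑ i, a i * f (x i)) ^ 2 := by
    rw [sq, Finset.sum_mul_sum, ← Finset.sum_sub_distrib]
    refine Finset.sum_congr rfl fun i _ => ?_
    rw [← Finset.sum_sub_distrib]
    exact Finset.sum_congr rfl fun j _ => by ring
  linarith

/-- The mixed second difference of a `C²` function at `0` is governed by its second derivative. -/
lemma exists_abs_mixed_difference_le {k : ℝ → ℝ} (hk : ContDiff ℝ 2 k) {ε : ℝ} (hε : 0 < ε) :
    ∃ δ > 0, ∀ s t : ℝ, |s| < δ → |t| < δ →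
      |k (s - t) - k s - k (-t) + k 0 + deriv (deriv k) 0 * (s * t)| ≤ ε * |s * t| := by
  set b := deriv (deriv k) 0 with hb
  have hk1 : ContDiff ℝ 1 (deriv k) := (contDiff_succ_iff_deriv (n := 1).1 hk).2.2
  have hd : Differentiable ℝ k := hk.differentiable (by norm_num)
  have hd1 : Differentiable ℝ (deriv k) := hk1.differentiable (by norm_num)
  have hc : Continuous (deriv (deriv k)) := hk1.continuous_deriv le_rfl
  obtain ⟨r, hr, hr'⟩ := Metric.continuous_iff.1 hc 0 ε hε
  have hlip : ∀ u ∈ Metric.ball (0 : ℝ) r, ∀ v ∈ Metric.ball (0 : ℝ) r,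
      ‖(deriv k v - b * v) - (deriv k u - b * u)‖ ≤ ε * ‖v - u‖ := by
    intro u hu v hv
    refine Convex.norm_image_sub_le_of_norm_hasDerivWithin_le (s := Metric.ball (0 : ℝ) r)
      (f := fun w => deriv k w - b * w) (f' := fun w => deriv (deriv k) w - b)
      (fun w _ => ?_) (fun w hw => ?_) (convex_ball _ _) hu hv
    · simpa using! ((hd1 w).hasDerivAt.sub ((hasDerivAt_id w).const_mul b)).hasDerivWithinAt
    · exact (hr' w hw).le
  refine ⟨r / 2, by positivity, fun s t hs ht => ?_⟩
  have key := Convex.norm_image_sub_le_of_norm_hasDerivWithin_le (s := Metric.ball (0 : ℝ) (r / 2))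
      (f := fun w => k (w - t) - k w + b * t * w)
      (f' := fun w => deriv k (w - t) - deriv k w + b * t) (C := ε * |t|) (x := 0) (y := s)
      (fun w _ => ?_) (fun w hw => ?_) (convex_ball _ _) (by simpa using hr) (by simpa using hs)
  · simp only [Real.norm_eq_abs, sub_zero, zero_sub, mul_zero, add_zero] at key
    calc _ = |k (s - t) - k s + b * t * s - (k (-t) - k 0)| := by congr 1; ring
      _ ≤ _ := key
      _ = _ := by rw [abs_mul]; ring
  · have h1 := (hd (w - t)).hasDerivAt.comp_sub_const w t
    simpa using! ((h1.sub (hd w).hasDerivAt).add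
      ((hasDerivAt_id w).const_mul (b * t))).hasDerivWithinAt
  · rw [mem_ball_zero_iff, Real.norm_eq_abs] at hw
    have := hlip w (by rw [mem_ball_zero_iff, Real.norm_eq_abs]; linarith) (w - t)
      (by
        rw [mem_ball_zero_iff, Real.norm_eq_abs]
        linarith [abs_sub w t])
    calc _ = ‖(deriv k (w - t) - b * (w - t)) - (deriv k w - b * w)‖ := by congr 1; ring
      _ ≤ _ := this
      _ = _ := by simp

lemma IsDominatedBy.differentiable {k f : ℝ → ℝ} (hk : ContDiff ℝ 2 k) (h : IsDominatedBy k f) :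
    Differentiable ℝ f := by
  intro x
  have hcauchy : Cauchy (map (fun t : ℝ => t⁻¹ • (f (x + t) - f x)) (𝓝[≠] 0)) := by
    refine Metric.cauchy_iff.2 ⟨inferInstance, fun η hη => ?_⟩
    obtain ⟨δ, hδ, H⟩ := exists_abs_mixed_difference_le hk (ε := (η / 4) ^ 2) (by positivity)
    refine ⟨_, image_mem_map (inter_mem_nhdsWithin _ (Metric.ball_mem_nhds 0 hδ)), ?_⟩
    rintro _ ⟨s, ⟨hs0, hs⟩, rfl⟩ _ ⟨t, ⟨ht0, ht⟩, rfl⟩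
    rw [mem_ball_zero_iff, Real.norm_eq_abs] at hs ht
    replace hs0 : s ≠ 0 := hs0
    replace ht0 : t ≠ 0 := ht0
    have key := h (Fin 3) ![s⁻¹, -t⁻¹, t⁻¹ - s⁻¹] ![x + s, x + t, x]
    have hE : ∀ u v : ℝ, u ≠ 0 → v ≠ 0 → |u| < δ → |v| < δ →
        |u⁻¹ * v⁻¹ * (k (u - v) - k u - k (-v) + k 0) + deriv (deriv k) 0| ≤ (η / 4) ^ 2 := by
      intro u v hu0 hv0 hu hv
      have h0 : 0 < |u * v| := by positivity
      rw [← mul_le_mul_iff_of_pos_right h0, ← abs_mul]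
      rw [show (u⁻¹ * v⁻¹ * (k (u - v) - k u - k (-v) + k 0) + deriv (deriv k) 0) * (u * v) =
        k (u - v) - k u - k (-v) + k 0 + deriv (deriv k) 0 * (u * v) by field_simp]
      exact H u v hu hv
    have e1 := abs_le.1 (hE s s hs0 hs0 hs hs)
    have e2 := abs_le.1 (hE s t hs0 ht0 hs ht)
    have e3 := abs_le.1 (hE t s ht0 hs0 ht hs)
    have e4 := abs_le.1 (hE t t ht0 ht0 ht ht)
    simp only [Fin.sum_univ_three, Matrix.cons_val_zero, Matrix.cons_val_one, Matrix.cons_val,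
      add_sub_add_left_eq_sub, sub_self, add_sub_cancel_left, sub_add_cancel_left] at key e1 e4
    have hsq : (s⁻¹ * (f (x + s) - f x) - t⁻¹ * (f (x + t) - f x)) ^ 2 ≤ 4 * (η / 4) ^ 2 := by
      linear_combination key + e1.2 + e2.1 + e3.1 + e4.2
    simp only [Real.dist_eq, smul_eq_mul]
    refine (abs_le_of_sq_le_sq (b := η / 2) (by linarith) (by positivity)).trans_lt (by linarith)
  obtain ⟨l, hl⟩ := cauchy_map_iff_exists_tendsto.1 hcauchy
  exact (hasDerivAt_iff_tendsto_slope_zero.2 hl).differentiableAt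

lemma tendsto_second_symmetric_difference {k : ℝ → ℝ} (hk : ContDiff ℝ 2 k) (u : ℝ) :
    Tendsto (fun t : ℝ => t⁻¹ ^ 2 * (2 * k u - k (u + t) - k (u - t))) (𝓝[≠] 0)
      (𝓝 (-deriv (deriv k) u)) := by
  have hk' : ContDiff ℝ 2 fun s => k (u + s) := hk.comp (contDiff_const.add contDiff_id)
  have hder : deriv (deriv fun s => k (u + s)) 0 = deriv (deriv k) u := by
    have : (deriv fun s => k (u + s)) = fun s => deriv k (u + s) :=
      funext fun s => deriv_comp_const_add k u s
    rw [this, deriv_comp_const_add (deriv k), add_zero]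
  rw [Metric.tendsto_nhdsWithin_nhds]
  intro ε hε
  obtain ⟨δ, hδ, H⟩ := exists_abs_mixed_difference_le hk' (half_pos hε)
  refine ⟨δ, hδ, fun t ht0 ht => ?_⟩
  replace ht0 : t ≠ 0 := ht0
  rw [Real.dist_eq, sub_zero] at ht
  have h0 : 0 < |t * t| := by positivity
  have key := H t t ht ht
  rw [hder] at key
  simp only [sub_self, add_zero, ← sub_eq_add_neg] at key
  refine lt_of_le_of_lt ?_ (half_lt_self hε)
  rw [Real.dist_eq, ← mul_le_mul_iff_of_pos_right h0, ← abs_mul]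
  rw [show (t⁻¹ ^ 2 * (2 * k u - k (u + t) - k (u - t)) - -deriv (deriv k) u) * (t * t) =
    k u - k (u + t) - k (u - t) + k u + deriv (deriv k) u * (t * t) by field_simp; ring]
  exact key

protected lemma IsDominatedBy.deriv {k f : ℝ → ℝ} (hk : ContDiff ℝ 2 k) (h : IsDominatedBy k f) :
    IsDominatedBy (-deriv (deriv k)) (deriv f) := by
  intro ι _ a x
  have hL : Tendsto (fun t : ℝ => (∑ i, a i * (t⁻¹ • (f (x i + t) - f (x i)))) ^ 2) (𝓝[≠] 0)
      (𝓝 ((∑ i, a i * deriv f (x i)) ^ 2)) :=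
    (tendsto_finsetSum _ fun i _ =>
      (hasDerivAt_iff_tendsto_slope_zero.1 (h.differentiable hk (x i)).hasDerivAt).const_mul _).pow 2
  have hR : Tendsto (fun t : ℝ => ∑ i, ∑ j, a i * a j *
        (t⁻¹ ^ 2 * (2 * k (x i - x j) - k (x i - x j + t) - k (x i - x j - t)))) (𝓝[≠] 0)
      (𝓝 (∑ i, ∑ j, a i * a j * (-deriv (deriv k)) (x i - x j))) :=
    tendsto_finsetSum _ fun i _ => tendsto_finsetSum _ fun j _ =>
      (tendsto_second_symmetric_difference hk _).const_mul _
  refine le_of_tendsto_of_tendsto' hL hR fun t => ?_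
  have key := h (ι ⊕ ι) (Sum.elim (fun i => t⁻¹ * a i) fun i => -(t⁻¹ * a i))
    (Sum.elim (fun i => x i + t) x)
  simp only [Fintype.sum_sum_type, Sum.elim_inl, Sum.elim_inr, ← Finset.sum_add_distrib] at key
  have e1 : ∑ i, (t⁻¹ * a i * f (x i + t) + -(t⁻¹ * a i) * f (x i)) =
      ∑ i, a i * (t⁻¹ • (f (x i + t) - f (x i))) :=
    Finset.sum_congr rfl fun i _ => by rw [smul_eq_mul]; ring
  rw [e1] at key
  refine key.trans_eq (Finset.sum_congr rfl fun i _ => Finset.sum_congr rfl fun j _ => ?_)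
  rw [show x i + t - (x j + t) = x i - x j by ring, show x i + t - x j = x i - x j + t by ring,
    show x i - (x j + t) = x i - x j - t by ring]
  ring

protected lemma IsDominatedBy.iteratedDeriv (n : ℕ) {k f : ℝ → ℝ} (hk : ContDiff ℝ ∞ k)
    (h : IsDominatedBy k f) :
    Differentiable ℝ (iteratedDeriv n f) ∧
      ∀ x, iteratedDeriv n f x ^ 2 ≤ |iteratedDeriv (2 * n) k 0| := by
  have hk2 : ContDiff ℝ 2 k := mod_cast contDiff_infty.1 hk 2
  induction n generalizing k f with
  | zero =>
    refine ⟨by simpa using h.differentiable hk2, fun x => ?_⟩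
    have := h (Fin 1) (fun _ => 1) (fun _ => x)
    simp only [Finset.univ_unique, Finset.sum_singleton, one_mul, sub_self] at this
    simpa using this.trans (le_abs_self _)
  | succ n ih =>
    have hk' : ContDiff ℝ ∞ (-deriv (deriv k)) :=
      ((contDiff_infty_iff_deriv.1 (contDiff_infty_iff_deriv.1 hk).2).2).neg
    obtain ⟨h1, h2⟩ := ih hk' (h.deriv hk2) (mod_cast contDiff_infty.1 hk' 2)
    rw [iteratedDeriv_succ']
    refine ⟨h1, fun x => (h2 x).trans_eq ?_⟩
    rw [show 2 * (n + 1) = 2 * n + 1 + 1 by ring, iteratedDeriv_succ', iteratedDeriv_succ',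
      iteratedDeriv_neg, abs_neg]

/-- A smooth function whose derivatives are bounded by `C * R ^ n * n!` is analytic. -/
lemma analyticAt_of_iteratedDeriv_bound {f : ℝ → ℝ} (hf : ContDiff ℝ ∞ f) {C R : ℝ} (hR : 0 < R)
    (hb : ∀ n x, |iteratedDeriv n f x| ≤ C * R ^ n * n !) (x : ℝ) : AnalyticAt ℝ f x := by
  have hC : 0 ≤ C := by simpa using (abs_nonneg _).trans (hb 0 0)
  set p := FormalMultilinearSeries.ofScalars ℝ (fun n ↦ iteratedDeriv n f x / n !) with hp
  have hrpos : 0 < (2 * R)⁻¹ := by positivity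
  refine ⟨p, ENNReal.ofReal (2 * R)⁻¹, ?_, by simpa using hR, fun {y} hy => ?_⟩
  · refine p.le_radius_of_bound C fun n => ?_
    rw [hp, FormalMultilinearSeries.ofScalars_norm, Real.norm_eq_abs, abs_div, Nat.abs_cast,
      Real.coe_toNNReal _ hrpos.le, div_mul_eq_mul_div, div_le_iff₀ (by positivity)]
    have h2 : (R * (2 * R)⁻¹) ^ n ≤ 1 := pow_le_one₀ (by positivity) (by
      rw [mul_inv_le_iff₀ (by positivity)]; linarith)
    calc _ ≤ C * R ^ n * n ! * (2 * R)⁻¹ ^ n := by gcongr; exact hb n x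
      _ = C * n ! * (R * (2 * R)⁻¹) ^ n := by rw [mul_pow]; ring
      _ ≤ C * n ! * 1 := by gcongr
      _ = _ := by ring
  · have hy' : R * |y| < 1 / 2 := by
      rw [Metric.mem_eball, edist_zero_right, ← ofReal_norm,
        ENNReal.ofReal_lt_ofReal_iff hrpos, Real.norm_eq_abs, inv_eq_one_div,
        lt_div_iff₀ (by positivity)] at hy
      linarith
    have hterm (n : ℕ) : (p n fun _ : Fin n => y) = iteratedDeriv n f x / n ! * y ^ n := by
      rw [hp, FormalMultilinearSeries.ofScalars_apply_eq, smul_eq_mul]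
    have hlim : Tendsto (fun n : ℕ => C * (R * |y|) ^ n) atTop (𝓝 0) := by
      simpa using (tendsto_pow_atTop_nhds_zero_of_lt_one (by positivity)
        (hy'.trans (by norm_num))).const_mul C
    have hsummable : Summable fun n : ℕ => p n fun _ : Fin n => y := by
      refine .of_norm_bounded (g := fun n => C * (R * |y|) ^ n)
        ((summable_geometric_of_lt_one (by positivity) (hy'.trans (by norm_num))).mul_left C)
        fun n => ?_
      rw [hterm, Real.norm_eq_abs, abs_mul, abs_div, abs_pow, Nat.abs_cast, mul_pow, ← mul_assoc]
      gcongr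
      exact (div_le_iff₀ (by positivity)).2 (hb n x)
    rw [hsummable.hasSum_iff_tendsto_nat, ← tendsto_add_atTop_iff_nat 1,
      tendsto_iff_norm_sub_tendsto_zero]
    refine squeeze_zero (fun _ => norm_nonneg _) (fun n => ?_)
      ((tendsto_add_atTop_iff_nat 1).2 hlim)
    simp only [hterm]
    rcases eq_or_ne y 0 with rfl | hy0
    · simp [Finset.sum_range_succ']
    have hne : x ≠ x + y := by simpa using hy0
    obtain ⟨z, -, hz⟩ := taylor_mean_remainder_lagrange_iteratedDeriv (n := n) hne
      (hf.of_le (mod_cast le_top)).contDiffOn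
    have htaylor : taylorWithinEval f n (uIcc x (x + y)) x (x + y) =
        ∑ i ∈ Finset.range (n + 1), iteratedDeriv i f x / i ! * y ^ i := by
      rw [taylor_within_apply]
      refine Finset.sum_congr rfl fun i _ => ?_
      rw [iteratedDerivWithin_eq_iteratedDeriv (uniqueDiffOn_uIcc hne)
        (hf.of_le (mod_cast le_top)).contDiffAt left_mem_uIcc, add_sub_cancel_left, smul_eq_mul]
      ring
    rw [← htaylor, norm_sub_rev, hz, add_sub_cancel_left, Real.norm_eq_abs, abs_div, abs_mul,
      abs_pow, Nat.abs_cast, div_le_iff₀ (by positivity), mul_pow]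
    calc _ ≤ C * R ^ (n + 1) * (n + 1)! * |y| ^ (n + 1) := by gcongr; exact hb _ _
      _ = _ := by ring

lemma exists_abs_iteratedDeriv_le {k : ℝ → ℝ} {x : ℝ} (hk : AnalyticAt ℝ k x) :
    ∃ C R : ℝ, 0 < C ∧ 0 < R ∧ ∀ n, |iteratedDeriv n k x| ≤ C * R ^ n * n ! := by
  obtain ⟨C, R, hC, hR, h⟩ :=
    FormalMultilinearSeries.le_mul_pow_of_radius_pos _ hk.hasFPowerSeriesAt.radius_pos
  refine ⟨C, R, hC, hR, fun n => ?_⟩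
  have := h n
  rwa [FormalMultilinearSeries.ofScalars_norm, Real.norm_eq_abs, abs_div, Nat.abs_cast,
    div_le_iff₀ (by positivity)] at this

lemma factorial_two_mul_le (n : ℕ) : (2 * n)! ≤ 4 ^ n * n ! ^ 2 := by
  have h := Nat.choose_mul_factorial_mul_factorial (show n ≤ 2 * n by omega)
  have h2 := Nat.choose_le_two_pow (2 * n) n
  rw [show 2 * n - n = n by omega] at h
  rw [← h, mul_assoc, ← sq, show 4 = 2 ^ 2 by norm_num, ← pow_mul]
  gcongr

lemma IsDominatedBy.analyticAt {k f : ℝ → ℝ} (hk : ∀ x, AnalyticAt ℝ k x) (h : IsDominatedBy k f)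
    (x : ℝ) : AnalyticAt ℝ f x := by
  have hk' : ContDiff ℝ ∞ k := AnalyticOnNhd.contDiff fun x _ => hk x
  obtain ⟨C, R, hC, hR, hb⟩ := exists_abs_iteratedDeriv_le (hk 0)
  have hf : ContDiff ℝ ∞ f :=
    contDiff_of_differentiable_iteratedDeriv fun n _ => (h.iteratedDeriv n hk').1
  refine analyticAt_of_iteratedDeriv_bound hf (C := C + 1) (R := 2 * R) (by positivity)
    (fun n y => ?_) x
  refine abs_le_of_sq_le_sq ?_ (by positivity)
  have hfac : ((2 * n)! : ℝ) ≤ 4 ^ n * (n ! : ℝ) ^ 2 := by exact_mod_cast factorial_two_mul_le n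
  calc _ ≤ C * R ^ (2 * n) * (2 * n)! := ((h.iteratedDeriv n hk').2 y).trans (hb _)
    _ ≤ C * R ^ (2 * n) * (4 ^ n * (n ! : ℝ) ^ 2) := by gcongr
    _ ≤ (C + 1) ^ 2 * R ^ (2 * n) * (4 ^ n * (n ! : ℝ) ^ 2) := by gcongr; nlinarith
    _ = _ := by
      rw [show (4 : ℝ) = 2 ^ 2 by norm_num, ← pow_mul]
      ring

end

/-- If `φ : ℝ → ℝ` is analytic on `ℝ` and `K(x,y) = φ((x-y)²)` is a PSD
kernel on `ℝ`, then every element of `H_K(ℝ)` is analytic: if `f : ℝ → ℝ` is such that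
`(x,y) ↦ K(x,y) - c² f(x) f(y)` is positive semidefinite for some `c > 0`, then `f` is
analytic on `ℝ`. -/
theorem stmt4_rkhs_elements_analytic
    (φ : ℝ → ℝ) (hφ : ∀ x : ℝ, AnalyticAt ℝ φ x)
    (K : ℝ → ℝ → ℝ) (hK : ∀ x y : ℝ, K x y = φ ((x - y) ^ 2))
    (hPSD : IsPSDKernel K)
    (f : ℝ → ℝ)
    (hf : ∃ c : ℝ, 0 < c ∧
      IsPSDKernel (fun p q : ℝ => K p q - c ^ 2 * f p * f q)) :
    ∀ x : ℝ, AnalyticAt ℝ f x := by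
  obtain ⟨c, hc, h⟩ := hf
  have hdom : IsDominatedBy (fun t => φ (t ^ 2)) (fun x => c * f x) := by
    refine IsPSDKernel.isDominatedBy ?_
    convert h using 3
    rw [hK]
    ring
  have hk : ∀ x, AnalyticAt ℝ (fun t => φ (t ^ 2)) x := fun x =>
    AnalyticAt.fun_comp (g := φ) (f := fun t : ℝ => t ^ 2) (hφ (x ^ 2)) (analyticAt_id.pow 2)
  intro x
  have h1 : AnalyticAt ℝ (fun y => c⁻¹ * (c * f y)) x :=
    analyticAt_const.mul (hdom.analyticAt hk x)
  simpa only [inv_mul_cancel_left₀ hc.ne'] using h1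
end

section
/- Let φ : ℝ → ℝ satisfy φ ≥ 0 on [0,∞), be analytic on a neighbourhood of [0,∞), and satisfy lim_{r→∞} φ(r) = 0, and suppose K(x,y) = φ((x−y)²) defines a positive-semidefinite kernel on ℝ. Let Ω ⊆ ℝ have an accumulation point and let f : Ω → ℝ. Suppose there exists an analytic function f_e : ℝ → ℝ with f_e|_Ω = f such that liminf_{x→−∞} |f_e(x)| > 0 or liminf_{x→∞} |f_e(x)| > 0. Then f ∉ H_K(Ω), i.e., there exists no function g : ℝ → ℝ such that (x,y) ↦ K(x,y) − c² g(x) g(y) is positive semidefinite on ℝ for some c > 0 and g(x) = f(x) for all x ∈ Ω. -/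
open Filter Topology

/-- The defining inequality of membership in an RKHS, for a finite set of points. -/
theorem IsPSDKernel.sq_sum_le {α : Type*} {K : α → α → ℝ} {g : α → ℝ} {c : ℝ}
    (h : IsPSDKernel (fun p q => K p q - c ^ 2 * g p * g q))
    {ι : Type*} (T : Finset ι) (a : ι → ℝ) (x : ι → α) :
    c ^ 2 * (∑ i ∈ T, a i * g (x i)) ^ 2 ≤
      ∑ i ∈ T, ∑ j ∈ T, a i * a j * K (x i) (x j) := by
  have h0 := h T.card (fun i => a (T.equivFin.symm i)) (fun i => x (T.equivFin.symm i))
  have e : ∀ F : ι → ℝ, ∑ i : Fin T.card, F (T.equivFin.symm i) = ∑ i ∈ T, F i := fun F => by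
    rw [Equiv.sum_comp T.equivFin.symm (fun i : T => F i), Finset.sum_coe_sort]
  have h2 : 0 ≤ ∑ i ∈ T, ∑ j ∈ T, a i * a j * (K (x i) (x j) - c ^ 2 * g (x i) * g (x j)) := by
    simpa only [← e] using h0
  have h1 : ∑ i ∈ T, ∑ j ∈ T, a i * a j * (K (x i) (x j) - c ^ 2 * g (x i) * g (x j)) =
      ∑ i ∈ T, ∑ j ∈ T, a i * a j * K (x i) (x j) - c ^ 2 * (∑ i ∈ T, a i * g (x i)) ^ 2 := by
    rw [sq (∑ i ∈ T, a i * g (x i)), Finset.sum_mul_sum, Finset.mul_sum,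
      ← Finset.sum_sub_distrib]
    refine Finset.sum_congr rfl fun i _ => ?_
    rw [Finset.mul_sum, ← Finset.sum_sub_distrib]
    exact Finset.sum_congr rfl fun j _ => by ring
  linarith

theorem sum_pow_mul_pow_le {r : ℝ} (hr : 0 ≤ r) (k : ℕ) :
    r * ∑ i ∈ Finset.range k, (2 * r) ^ i * r ^ (k - 1 - i) ≤ (2 * r) ^ k := by
  have h : r * ∑ i ∈ Finset.range k, (2 * r) ^ i * r ^ (k - 1 - i)
      = r * ((2 * r) ^ k - r ^ k) / (2 * r - r) ∨ r = 0 := by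
    by_cases h0 : r = 0
    · exact Or.inr h0
    · left
      rw [← (Commute.all (2 * r) r).geom_sum₂_mul]
      field_simp
  rcases h with h | h
  · rw [h]
    by_cases h0 : r = 0
    · subst h0; simp
    · rw [show 2 * r - r = r by ring, mul_div_assoc, mul_div_cancel₀ _ h0]
      have := pow_nonneg hr k
      linarith
  · subst h; simp

/-- The error functional of Lagrange interpolation at the nodes `S`, evaluated at `x`:
it kills low-degree monomials, and its values on all monomials grow at most geometrically. -/
theorem exists_interpolation_error {r x : ℝ} (hx : |x| ≤ r) (S : Finset ℝ)
    (hS : ∀ y ∈ S, |y| ≤ r) (hxS : x ∉ S) :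
    ∃ a : ℝ → ℝ, a x = 1 ∧
      (∀ k < S.card, ∑ y ∈ insert x S, a y * y ^ k = 0) ∧
      ∀ k, |∑ y ∈ insert x S, a y * y ^ k| ≤ 2 ^ S.card * (2 * r) ^ k := by
  have hr : 0 ≤ r := (abs_nonneg x).trans hx
  induction S using Finset.induction_on with
  | empty =>
    refine ⟨fun _ => 1, rfl, by simp, fun k => ?_⟩
    simp only [insert_empty_eq, Finset.sum_singleton, one_mul, abs_pow, Finset.card_empty, pow_zero]
    exact pow_le_pow_left₀ (abs_nonneg x) (by linarith) k
  | insert b S hb ih =>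
    obtain ⟨a, hax, ha0, hak⟩ := ih (fun y hy => hS y (Finset.mem_insert_of_mem hy))
      (fun h => hxS (Finset.mem_insert_of_mem h))
    have hbr : |b| ≤ r := hS b (Finset.mem_insert_self b S)
    have hxb : x ≠ b := fun h => hxS (h ▸ Finset.mem_insert_self x S)
    have hbT : b ∉ insert x S := by simp [hb, hxb.symm]
    let a' : ℝ → ℝ := fun y =>
      if y = b then -∑ z ∈ insert x S, (x - b) * a z / (z - b) else (x - b) * a y / (y - b)
    have key : ∀ k, ∑ y ∈ insert x (insert b S), a' y * y ^ k =
        (x - b) * ∑ i ∈ Finset.range k, (∑ y ∈ insert x S, a y * y ^ i) * b ^ (k - 1 - i) := by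
      intro k
      rw [Finset.insert_comm, Finset.sum_insert hbT]
      have h1 : ∑ y ∈ insert x S, a' y * y ^ k =
          ∑ y ∈ insert x S, (x - b) * a y / (y - b) * y ^ k :=
        Finset.sum_congr rfl fun y hy => by
          have : y ≠ b := fun h => hbT (h ▸ hy)
          simp [a', this]
      rw [h1]
      simp only [a', if_true]
      rw [neg_mul, Finset.sum_mul, neg_add_eq_sub, ← Finset.sum_sub_distrib]
      simp_rw [Finset.sum_mul]
      rw [Finset.sum_comm, Finset.mul_sum]
      refine Finset.sum_congr rfl fun y hy => ?_
      have hyb : y - b ≠ 0 := sub_ne_zero.2 fun h => hbT (h ▸ hy)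
      simp_rw [mul_assoc (a y)]
      rw [← Finset.mul_sum, ← mul_sub, ← (Commute.all y b).geom_sum₂_mul]
      field_simp
    refine ⟨a', ?_, fun k hk => ?_, fun k => ?_⟩
    · simp only [a', if_neg hxb, hax, mul_one]
      exact div_self (sub_ne_zero.2 hxb)
    · rw [Finset.card_insert_of_notMem hb] at hk
      rw [key, Finset.sum_eq_zero fun i hi => ?_, mul_zero]
      rw [ha0 i (by have := Finset.mem_range.1 hi; omega), zero_mul]
    · rw [key, Finset.card_insert_of_notMem hb, abs_mul]
      have h2 : |x - b| ≤ 2 * r := (abs_sub x b).trans (by linarith)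
      have h3 : |∑ i ∈ Finset.range k, (∑ y ∈ insert x S, a y * y ^ i) * b ^ (k - 1 - i)| ≤
          2 ^ S.card * ∑ i ∈ Finset.range k, (2 * r) ^ i * r ^ (k - 1 - i) := by
        refine (Finset.abs_sum_le_sum_abs _ _).trans ?_
        rw [Finset.mul_sum]
        refine Finset.sum_le_sum fun i _ => ?_
        rw [abs_mul, abs_pow, ← mul_assoc]
        exact mul_le_mul (hak i) (pow_le_pow_left₀ (abs_nonneg b) hbr _) (by positivity)
          (by positivity)
      calc _ ≤ 2 * r * (2 ^ S.card * ∑ i ∈ Finset.range k, (2 * r) ^ i * r ^ (k - 1 - i)) :=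
            mul_le_mul h2 h3 (abs_nonneg _) (by positivity)
        _ = 2 ^ (S.card + 1) * (r * ∑ i ∈ Finset.range k, (2 * r) ^ i * r ^ (k - 1 - i)) := by
            ring
        _ ≤ _ := by gcongr; exact sum_pow_mul_pow_le hr k

theorem abs_le_of_hasSum_of_eq_zero_of_lt {c e : ℕ → ℝ} {V σ : ℝ} {n : ℕ} (hσ : 0 ≤ σ)
    (hV : HasSum (fun k => c k * e k) V) (he0 : ∀ k < n, e k = 0) (he : ∀ k, |e k| ≤ σ ^ k)
    (hc : Summable fun k => |c k| * (2 * σ) ^ k) :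
    |V| ≤ (∑' k, |c k| * (2 * σ) ^ k) * (1 / 2) ^ n := by
  have hb : ∀ k, ‖c k * e k‖ ≤ |c k| * (2 * σ) ^ k * (1 / 2) ^ n := by
    intro k
    rw [Real.norm_eq_abs, abs_mul, mul_assoc]
    refine mul_le_mul_of_nonneg_left ?_ (abs_nonneg _)
    rcases lt_or_ge k n with hk | hk
    · rw [he0 k hk, abs_zero]; positivity
    · calc |e k| ≤ σ ^ k := he k
        _ = (2 * σ) ^ k * (1 / 2) ^ k := by rw [← mul_pow]; ring
        _ ≤ _ := by
          gcongr ?_ * ?_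
          exact pow_le_pow_of_le_one (by norm_num) (by norm_num) hk
  rw [← hV.tsum_eq, ← tsum_mul_right]
  exact tsum_of_norm_bounded (hc.mul_right _).hasSum hb

theorem exists_hasSum_pow_of_analyticAt {f : ℝ → ℝ} {p : ℝ} (hf : AnalyticAt ℝ f p) :
    ∃ ρ > 0, ∃ c : ℕ → ℝ, (∀ z, |z| ≤ ρ → HasSum (fun k => c k * z ^ k) (f (p + z))) ∧
      ∀ z, |z| ≤ ρ → Summable fun k => |c k| * z ^ k := by
  obtain ⟨P, hP⟩ := hf
  rw [hasFPowerSeriesAt_iff, Metric.eventually_nhds_iff] at hP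
  obtain ⟨ε, hε, h⟩ := hP
  have hs : ∀ z, |z| ≤ ε / 2 → HasSum (fun k => P.coeff k * z ^ k) (f (p + z)) := fun z hz => by
    simpa [mul_comm] using h (y := z) (by rw [dist_zero_right, Real.norm_eq_abs]; linarith)
  refine ⟨ε / 2, half_pos hε, P.coeff, hs, fun z hz => ?_⟩
  refine (hs z hz).summable.abs.of_norm_bounded fun k => ?_
  simp [abs_mul]

theorem abs_double_sum_sub_pow {T : Finset ℝ} {a : ℝ → ℝ} {n : ℕ} {σ : ℝ}
    (h0 : ∀ k < n, ∑ y ∈ T, a y * y ^ k = 0)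
    (h : ∀ k, |∑ y ∈ T, a y * y ^ k| ≤ σ ^ k) :
    (∀ k < n, ∑ y ∈ T, ∑ z ∈ T, a y * a z * (y - z) ^ k = 0) ∧
      ∀ k, |∑ y ∈ T, ∑ z ∈ T, a y * a z * (y - z) ^ k| ≤ (2 * σ) ^ k := by
  have key : ∀ k, ∑ y ∈ T, ∑ z ∈ T, a y * a z * (y - z) ^ k =
      ∑ j ∈ Finset.range (k + 1), (∑ y ∈ T, a y * y ^ j) * (∑ z ∈ T, a z * z ^ (k - j)) *
        ((-1) ^ (k - j) * k.choose j) := by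
    intro k
    simp_rw [Finset.sum_mul_sum, Finset.sum_mul]
    rw [Finset.sum_comm (s := Finset.range (k + 1))]
    refine Finset.sum_congr rfl fun y _ => ?_
    rw [Finset.sum_comm]
    refine Finset.sum_congr rfl fun z _ => ?_
    rw [sub_eq_add_neg, add_pow, Finset.mul_sum]
    refine Finset.sum_congr rfl fun j _ => ?_
    rw [neg_pow]
    ring
  refine ⟨fun k hk => ?_, fun k => ?_⟩
  · rw [key]
    refine Finset.sum_eq_zero fun j hj => ?_
    rw [h0 j (by have := Finset.mem_range.1 hj; omega), zero_mul, zero_mul]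
  · rw [key]
    refine (Finset.abs_sum_le_sum_abs _ _).trans ?_
    have : (2 * σ) ^ k = ∑ j ∈ Finset.range (k + 1), σ ^ j * σ ^ (k - j) * k.choose j := by
      rw [two_mul, add_pow]
    rw [this]
    refine Finset.sum_le_sum fun j _ => ?_
    rw [abs_mul, abs_mul, abs_mul, abs_pow, abs_neg, abs_one, one_pow, one_mul, Nat.abs_cast]
    gcongr
    · exact (abs_nonneg _).trans (h j)
    · exact h j
    · exact h (k - j)

/-- A member of the RKHS of a translation-invariant kernel analytic on the diagonal agrees with
an analytic function near every accumulation point of their coincidence set. -/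
theorem eventually_eq_of_accPt_of_isPSDKernel {ψ g f : ℝ → ℝ} {c p : ℝ} (hc : 0 < c)
    (hψ : AnalyticAt ℝ ψ 0) (hg : IsPSDKernel fun x y => ψ (x - y) - c ^ 2 * g x * g y)
    (hf : AnalyticAt ℝ f p) (hp : AccPt p (𝓟 {x | g x = f x})) :
    ∀ᶠ x in 𝓝 p, g x = f x := by
  obtain ⟨ρ₁, hρ₁, u, hu, hu'⟩ := exists_hasSum_pow_of_analyticAt hψ
  obtain ⟨ρ₂, hρ₂, v, hv, hv'⟩ := exists_hasSum_pow_of_analyticAt hf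
  obtain ⟨r, hr, h1, h2⟩ : ∃ r > 0, 16 * r ≤ ρ₁ ∧ 16 * r ≤ ρ₂ :=
    ⟨min ρ₁ ρ₂ / 16, by positivity, by linarith [min_le_left ρ₁ ρ₂],
      by linarith [min_le_right ρ₁ ρ₂]⟩
  have hinf : {s | |s| ≤ r ∧ g (p + s) = f (p + s)}.Infinite := by
    have := accPt_iff_frequently_nhdsNE.1 hp
    have h3 : ∃ᶠ y in 𝓝[≠] p, y ∈ {x | g x = f x} ∩ Metric.closedBall p r :=
      this.and_eventually (mem_nhdsWithin_of_mem_nhds (Metric.closedBall_mem_nhds p hr))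
    have h4 := Set.Infinite.of_accPt (accPt_iff_frequently_nhdsNE.2 h3)
    refine Set.Infinite.of_image (fun s => p + s) (h4.mono ?_)
    rintro y ⟨hy, hy'⟩
    refine ⟨y - p, ⟨?_, ?_⟩, by simp⟩
    · simpa [Real.dist_eq] using hy'
    · simpa using hy
  have main : ∀ x, |x| ≤ r → g (p + x) = f (p + x) := by
    intro x hx
    by_contra hne
    set A := ∑' k, |u k| * (2 * (8 * r)) ^ k
    set B := ∑' k, |v k| * (2 * (4 * r)) ^ k
    have bound : ∀ n : ℕ, (g (p + x) - f (p + x)) ^ 2 ≤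
        (2 * A / c ^ 2 + 2 * B ^ 2) * (1 / 2) ^ n := by
      intro n
      obtain ⟨S, hS, rfl⟩ := hinf.exists_subset_card_eq n
      have hxS : x ∉ S := fun h => hne (hS h).2
      obtain ⟨a, hax, ha0, ha⟩ := exists_interpolation_error hx S (fun y hy => (hS hy).1) hxS
      have ha' : ∀ k, |∑ y ∈ insert x S, a y * y ^ k| ≤ (4 * r) ^ k := by
        intro k
        rcases lt_or_ge k S.card with hk | hk
        · rw [ha0 k hk, abs_zero]; positivity
        · refine (ha k).trans ?_
          rw [show 4 * r = 2 * (2 * r) by ring, mul_pow 2 (2 * r)]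
          gcongr
          norm_num
      have hT : ∀ y ∈ insert x S, |y| ≤ r := by
        intro y hy
        rcases Finset.mem_insert.1 hy with rfl | hy
        · exact hx
        · exact (hS hy).1
      have hEf : HasSum (fun k => v k * ∑ y ∈ insert x S, a y * y ^ k)
          (∑ y ∈ insert x S, a y * f (p + y)) := by
        have := hasSum_sum fun y (hy : y ∈ insert x S) =>
          (hv y ((hT y hy).trans (by linarith))).mul_left (a y)
        refine this.congr_fun fun k => ?_
        rw [Finset.mul_sum]
        exact Finset.sum_congr rfl fun y _ => by ring
      have hEψ : HasSum (fun k => u k * ∑ y ∈ insert x S, ∑ z ∈ insert x S, a y * a z * (y - z) ^ k)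
          (∑ y ∈ insert x S, ∑ z ∈ insert x S, a y * a z * ψ (y - z)) := by
        have := hasSum_sum fun y (hy : y ∈ insert x S) =>
          hasSum_sum fun z (hz : z ∈ insert x S) => (hu (y - z) ((abs_sub y z).trans
            (by linarith [hT y hy, hT z hz]))).mul_left (a y * a z)
        simp only [zero_add] at this
        refine this.congr_fun fun k => ?_
        simp_rw [Finset.mul_sum]
        exact Finset.sum_congr rfl fun y _ => Finset.sum_congr rfl fun z _ => by ring
      obtain ⟨hd0, hd⟩ := abs_double_sum_sub_pow ha0 ha'
      have b1 : |∑ y ∈ insert x S, a y * f (p + y)| ≤ B * (1 / 2) ^ S.card :=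
        abs_le_of_hasSum_of_eq_zero_of_lt (by positivity) hEf ha0 ha'
          (hv' _ (by rw [abs_of_nonneg (by positivity)]; linarith))
      have b2 : |∑ y ∈ insert x S, ∑ z ∈ insert x S, a y * a z * ψ (y - z)| ≤
          A * (1 / 2) ^ S.card :=
        abs_le_of_hasSum_of_eq_zero_of_lt (σ := 8 * r) (by positivity) hEψ hd0
          (fun k => (hd k).trans_eq (by ring))
          (hu' _ (by rw [abs_of_nonneg (by positivity)]; linarith))
      have b3 := hg.sq_sum_le (K := fun x y => ψ (x - y)) (insert x S) a (fun y => p + y)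
      simp only [add_sub_add_left_eq_sub] at b3
      have hdiff : g (p + x) - f (p + x) =
          ∑ y ∈ insert x S, a y * g (p + y) - ∑ y ∈ insert x S, a y * f (p + y) := by
        rw [Finset.sum_insert hxS, Finset.sum_insert hxS, hax,
          Finset.sum_congr rfl fun y hy => by rw [(hS hy).2]]
        ring
      rw [hdiff]
      set G := ∑ y ∈ insert x S, a y * g (p + y)
      set F := ∑ y ∈ insert x S, a y * f (p + y)
      have q : (1 / 2 : ℝ) ^ S.card ≤ 1 := pow_le_one₀ (by norm_num) (by norm_num)
      have q0 : (0 : ℝ) ≤ (1 / 2 : ℝ) ^ S.card := by positivity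
      set t := (1 / 2 : ℝ) ^ S.card
      have b4 : G ^ 2 ≤ A / c ^ 2 * t := by
        rw [div_mul_eq_mul_div, le_div_iff₀ (by positivity)]
        linarith [le_abs_self (∑ y ∈ insert x S, ∑ z ∈ insert x S, a y * a z * ψ (y - z))]
      have b5 : F ^ 2 ≤ B ^ 2 * t := by
        calc F ^ 2 ≤ (B * t) ^ 2 := sq_le_sq.2 (b1.trans (le_abs_self _))
          _ = B ^ 2 * (t * t) := by ring
          _ ≤ B ^ 2 * t := by gcongr; exact mul_le_of_le_one_left q0 q
      have : 2 * A / c ^ 2 = 2 * (A / c ^ 2) := by ring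
      rw [this]
      nlinarith [sq_nonneg (G + F)]
    have hlim := (tendsto_pow_atTop_nhds_zero_of_lt_one (r := (1 / 2 : ℝ)) (by norm_num)
      (by norm_num)).const_mul (2 * A / c ^ 2 + 2 * B ^ 2)
    have := ge_of_tendsto' hlim bound
    rw [mul_zero] at this
    exact hne (sub_eq_zero.1 (pow_eq_zero_iff two_ne_zero |>.1 (le_antisymm this (sq_nonneg _))))
  filter_upwards [Metric.closedBall_mem_nhds p hr] with y hy
  have := main (y - p) (by simpa [Real.dist_eq] using hy)
  simpa using this

theorem eq_of_accPt_of_isPSDKernel {ψ g f : ℝ → ℝ} {c p : ℝ} (hc : 0 < c)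
    (hψ : AnalyticAt ℝ ψ 0) (hg : IsPSDKernel fun x y => ψ (x - y) - c ^ 2 * g x * g y)
    (hf : ∀ x, AnalyticAt ℝ f x) (hp : AccPt p (𝓟 {x | g x = f x})) : g = f := by
  have hloc := fun q => eventually_eq_of_accPt_of_isPSDKernel hc hψ hg (hf q)
  have hopen : IsOpen {q | ∀ᶠ x in 𝓝 q, g x = f x} := isOpen_setOfPred_eventually_nhds
  have hclosed : IsClosed {q | ∀ᶠ x in 𝓝 q, g x = f x} := by
    refine isClosed_of_closure_subset fun q hq => ?_
    by_cases hq' : q ∈ {q | ∀ᶠ x in 𝓝 q, g x = f x}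
    · exact hq'
    · refine hloc q ?_
      have : AccPt q (𝓟 {q | ∀ᶠ x in 𝓝 q, g x = f x}) := by
        rcases mem_closure_iff_clusterPt.1 hq |> clusterPt_principal.1 with h | h
        · exact absurd h hq'
        · exact h
      exact this.mono (principal_mono.2 fun x hx => Eventually.self_of_nhds hx)
  have huniv := IsClopen.eq_univ ⟨hclosed, hopen⟩ ⟨p, hloc p hp⟩
  funext x
  exact (Set.eq_univ_iff_forall.1 huniv x).self_of_nhds

/-- A member of the RKHS of a decaying kernel is not bounded away from zero along a sequence of
arbitrarily widely spaced points. -/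
theorem false_of_isPSDKernel_of_le_abs {φ g : ℝ → ℝ} {c δ T s : ℝ} (hc : 0 < c) (hδ : 0 < δ)
    (hs : |s| = 1) (hφ_nonneg : ∀ r, 0 ≤ r → 0 ≤ φ r) (hφ : Tendsto φ atTop (𝓝 0))
    (hg : IsPSDKernel fun x y => φ ((x - y) ^ 2) - c ^ 2 * g x * g y)
    (hgδ : ∀ x, T ≤ x → δ ≤ |g (s * x)|) : False := by
  set ε := c ^ 2 * δ ^ 2 / 2 with hε
  have hε0 : 0 < ε := by positivity
  obtain ⟨R, hR⟩ := eventually_atTop.1 (hφ.eventually (ge_mem_nhds hε0))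
  set L := max R 1
  have hL1 : 1 ≤ L := le_max_right _ _
  obtain ⟨N, hN⟩ := exists_nat_gt (φ 0 / ε)
  have hφ0 := hφ_nonneg 0 le_rfl
  have hN0 : (0 : ℝ) < N := (div_nonneg hφ0 hε0.le).trans_lt hN
  let x : ℕ → ℝ := fun n => s * (T + n * L)
  have hgx : ∀ n, δ ≤ |g (x n)| := fun n => hgδ _ (by
    have : 0 ≤ (n : ℝ) * L := by positivity
    linarith)
  have hgx0 : ∀ n, g (x n) ≠ 0 := fun n => abs_pos.1 (hδ.trans_le (hgx n))
  have hineq := hg.sq_sum_le (K := fun x y => φ ((x - y) ^ 2)) (Finset.range N)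
    (fun n => (g (x n))⁻¹) x
  simp only [inv_mul_cancel₀ (hgx0 _), Finset.sum_const, Finset.card_range, nsmul_eq_mul,
    mul_one] at hineq
  have hterm : ∀ n m, (g (x n))⁻¹ * (g (x m))⁻¹ * φ ((x n - x m) ^ 2) ≤
      (δ ^ 2)⁻¹ * ((if n = m then φ 0 else 0) + ε) := by
    intro n m
    have h1 : (g (x n))⁻¹ * (g (x m))⁻¹ ≤ (δ ^ 2)⁻¹ := by
      rw [← mul_inv]
      refine (le_abs_self _).trans ?_
      rw [abs_inv, abs_mul, sq]
      gcongr
      · exact hgx n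
      · exact hgx m
    have h2 : φ ((x n - x m) ^ 2) ≤ (if n = m then φ 0 else 0) + ε := by
      split_ifs with h
      · subst h; simp [hε0.le]
      · rw [zero_add]
        refine hR _ ?_
        have h3 : (x n - x m) ^ 2 = ((n : ℝ) - m) ^ 2 * L ^ 2 := by
          have : s ^ 2 = 1 := by rw [← sq_abs, hs, one_pow]
          calc (x n - x m) ^ 2 = s ^ 2 * (((n : ℝ) - m) ^ 2 * L ^ 2) := by simp only [x]; ring
            _ = _ := by rw [this, one_mul]
        have h4 : (1 : ℝ) ≤ ((n : ℝ) - m) ^ 2 := by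
          have : (n : ℤ) - m ≠ 0 := sub_ne_zero.2 (by exact_mod_cast h)
          have h5 : 1 ≤ ((n : ℤ) - m) ^ 2 := by
            have := sq_pos_of_ne_zero this
            omega
          exact_mod_cast h5
        rw [h3]
        have : R ≤ L := le_max_left _ _
        nlinarith
    exact mul_le_mul h1 h2 (hφ_nonneg _ (sq_nonneg _)) (by positivity)
  have hsum : ∑ n ∈ Finset.range N, ∑ m ∈ Finset.range N,
      (g (x n))⁻¹ * (g (x m))⁻¹ * φ ((x n - x m) ^ 2) ≤
        (δ ^ 2)⁻¹ * (N * φ 0 + N ^ 2 * ε) := by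
    refine (Finset.sum_le_sum fun n _ => Finset.sum_le_sum fun m _ => hterm n m).trans_eq ?_
    simp_rw [← Finset.mul_sum, Finset.sum_add_distrib]
    rw [Finset.sum_congr rfl fun n hn => by rw [Finset.sum_ite_eq, if_pos hn]]
    simp only [Finset.sum_const, Finset.card_range, nsmul_eq_mul]
    ring
  have hfin := hineq.trans hsum
  rw [inv_mul_eq_div, le_div_iff₀ (by positivity)] at hfin
  have hlt : φ 0 < N * ε := by rwa [div_lt_iff₀ hε0] at hN
  nlinarith

theorem exists_eventually_le_abs_of_liminf_pos {F : Filter ℝ} {f : ℝ → ℝ}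
    (h : (0 : EReal) < liminf (fun x => ((|f x| : ℝ) : EReal)) F) :
    ∃ δ > 0, ∀ᶠ x in F, δ ≤ |f x| := by
  obtain ⟨δ, hδ0, hδ⟩ := EReal.lt_iff_exists_real_btwn.1 h
  refine ⟨δ, by exact_mod_cast hδ0, ?_⟩
  filter_upwards [eventually_lt_of_lt_liminf hδ] with x hx
  exact_mod_cast hx.le

/-- Let `φ ≥ 0` on `[0,∞)` be analytic on a neighbourhood of `[0,∞)` with
`φ(r) → 0` as `r → ∞`, and suppose `K(x,y) = φ((x-y)²)` is PSD on `ℝ`. Let `Ω ⊆ ℝ` have an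
accumulation point and `f : Ω → ℝ`. If `f` admits an analytic extension `f_e : ℝ → ℝ` with
`liminf_{x→-∞} |f_e(x)| > 0` or `liminf_{x→∞} |f_e(x)| > 0`, then `f ∉ H_K(Ω)`: no
`g ∈ H_K(ℝ)` agrees with `f` on `Ω`. -/
theorem stmt5_analytic_translation_invariant_not_in_rkhs
    (φ : ℝ → ℝ) (hφ_nonneg : ∀ r : ℝ, 0 ≤ r → 0 ≤ φ r)
    (hφ_analytic : ∀ r : ℝ, 0 ≤ r → AnalyticAt ℝ φ r)
    (hφ_decay : Filter.Tendsto φ Filter.atTop (nhds 0))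
    (K : ℝ → ℝ → ℝ) (hK : ∀ x y : ℝ, K x y = φ ((x - y) ^ 2))
    (hPSD : IsPSDKernel K)
    (Ω : Set ℝ) (hΩ : ∃ p : ℝ, AccPt p (Filter.principal Ω))
    (f : Ω → ℝ)
    (f_e : ℝ → ℝ) (hfe_analytic : ∀ v : ℝ, AnalyticAt ℝ f_e v)
    (hext : ∀ v : Ω, f_e v = f v)
    (hliminf :
      (0 : EReal) < Filter.liminf (fun x : ℝ => ((|f_e x| : ℝ) : EReal)) Filter.atBot ∨
      (0 : EReal) < Filter.liminf (fun x : ℝ => ((|f_e x| : ℝ) : EReal)) Filter.atTop) :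
    ¬ ∃ g : ℝ → ℝ, MemRKHS K g ∧ ∀ v : Ω, g v = f v := by
  rintro ⟨g, ⟨c, hc, hg⟩, hgf⟩
  obtain rfl : K = fun x y => φ ((x - y) ^ 2) := by funext x y; exact hK x y
  obtain ⟨p, hp⟩ := hΩ
  have hψ : AnalyticAt ℝ (fun t : ℝ => φ (t ^ 2)) 0 :=
    AnalyticAt.fun_comp (hφ_analytic _ (sq_nonneg 0)) (analyticAt_id.pow 2)
  obtain rfl : g = f_e := eq_of_accPt_of_isPSDKernel hc hψ hg hfe_analytic
    (hp.mono (Filter.principal_mono.2 fun x hx => (hgf ⟨x, hx⟩).trans (hext ⟨x, hx⟩).symm))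
  rcases hliminf with h | h
  · obtain ⟨δ, hδ, hev⟩ := exists_eventually_le_abs_of_liminf_pos h
    obtain ⟨T, hT⟩ := eventually_atBot.1 hev
    exact false_of_isPSDKernel_of_le_abs (T := -T) (s := -1) hc hδ (by simp) hφ_nonneg hφ_decay hg
      fun x hx => hT _ (by linarith)
  · obtain ⟨δ, hδ, hev⟩ := exists_eventually_le_abs_of_liminf_pos h
    obtain ⟨T, hT⟩ := eventually_atTop.1 hev
    exact false_of_isPSDKernel_of_le_abs (T := T) (s := 1) hc hδ (by simp) hφ_nonneg hφ_decay hg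
      fun x hx => hT _ (by linarith)
end

section
/- Let φ : ℝ → ℝ be analytic on ℝ and define K(x,y) = φ((x−y)²). Then for every n ≥ 0 and every x ∈ ℝ, the mixed iterated partial derivative of K of order n in each variable evaluated at equal arguments satisfies D^{n,n} K(x,x) = (∂^{2n}/∂v^n ∂w^n) K(v,w)|_{v=w=x} = (−1)^n · ((2n)!/n!) · φ^{(n)}(0), where φ^{(n)}(0) is the n-th derivative of φ at 0. -/
open scoped ContDiff in
theorem iteratedDeriv_succ_id_mul_zero {g : ℝ → ℝ} (hg : ContDiff ℝ ∞ g) (m : ℕ) :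
    iteratedDeriv (m + 1) (fun t : ℝ => t * g t) 0 = (m + 1) * iteratedDeriv m g 0 := by
  rw [iteratedDeriv_fun_mul contDiffAt_fun_id (hg.of_le (by exact_mod_cast le_top)).contDiffAt]
  simp [iteratedDeriv_fun_id_zero]

open scoped ContDiff in
theorem iteratedDeriv_two_mul_comp_sq_zero {φ : ℝ → ℝ} (hφ : ContDiff ℝ ∞ φ) (n : ℕ) :
    iteratedDeriv (2 * n) (fun t : ℝ => φ (t ^ 2)) 0 =
      ((2 * n).factorial : ℝ) / (n.factorial : ℝ) * iteratedDeriv n φ 0 := by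
  induction n generalizing φ with
  | zero => simp
  | succ n ih =>
    obtain ⟨hd, hφ'⟩ := contDiff_infty_iff_deriv.mp hφ
    have hderiv : deriv (fun t : ℝ => φ (t ^ 2)) = fun t => 2 * (t * deriv φ (t ^ 2)) := by
      funext t
      have h := (hd (t ^ 2)).hasDerivAt.comp t (hasDerivAt_pow 2 t)
      rw [show (fun t : ℝ => φ (t ^ 2)) = φ ∘ fun t => t ^ 2 from rfl, h.deriv]
      push_cast
      ring
    have hg : ContDiff ℝ ∞ (fun t : ℝ => deriv φ (t ^ 2)) := hφ'.comp (contDiff_id.pow 2)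
    rw [show 2 * (n + 1) = 2 * n + 1 + 1 by ring, iteratedDeriv_succ', hderiv,
      iteratedDeriv_const_mul_field, iteratedDeriv_succ_id_mul_zero hg, ih hφ',
      iteratedDeriv_succ' (n := n)]
    simp only [Nat.factorial_succ]
    push_cast
    have := Nat.factorial_ne_zero n
    field_simp
    ring


/-- For an analytic profile `φ : ℝ → ℝ` and the translation-invariant
kernel `K(x,y) = φ((x-y)²)`, the mixed iterated partial derivative of order `n` in each
variable evaluated on the diagonal satisfies
`D^{n,n} K(x,x) = (-1)^n ((2n)!/n!) φ^{(n)}(0)`. -/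
theorem stmt6_mixed_derivative_on_diagonal
    (φ : ℝ → ℝ) (hφ : ∀ x : ℝ, AnalyticAt ℝ φ x)
    (K : ℝ → ℝ → ℝ) (hK : ∀ x y : ℝ, K x y = φ ((x - y) ^ 2)) :
    ∀ (n : ℕ) (x : ℝ),
      iteratedDeriv n (fun w : ℝ => iteratedDeriv n (fun v : ℝ => K v w) x) x =
        (-1 : ℝ) ^ n * (((2 * n).factorial : ℝ) / (n.factorial : ℝ)) *
          iteratedDeriv n φ 0 := by
  intro n x
  have hs : ContDiff ℝ (⊤ : ℕ∞) φ := contDiff_iff_contDiffAt.mpr fun y => (hφ y).contDiffAt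
  have hinner (w : ℝ) : iteratedDeriv n (fun v : ℝ => K v w) x =
      iteratedDeriv n (fun t : ℝ => φ (t ^ 2)) (x - w) := by
    simp only [hK]
    exact congrFun (iteratedDeriv_comp_sub_const n (fun t : ℝ => φ (t ^ 2)) w) x
  have hiter : iteratedDeriv n (iteratedDeriv n fun t : ℝ => φ (t ^ 2)) =
      iteratedDeriv (2 * n) fun t : ℝ => φ (t ^ 2) := by
    simp only [iteratedDeriv_eq_iterate, two_mul, Function.iterate_add_apply]
  simp only [hinner]
  rw [iteratedDeriv_comp_const_sub, hiter]
  simp only [sub_self, smul_eq_mul]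
  rw [iteratedDeriv_two_mul_comp_sq_zero hs, mul_assoc]
end

section
/- Let K(x,y) = exp(−(x−y)²) be the Gaussian kernel on ℝ, let Ω ⊆ ℝ be a set having an accumulation point, and let p : ℝ → ℝ be a polynomial that is not identically zero. Then p|_Ω ∉ H_K(Ω); concretely, there exists no function g : ℝ → ℝ such that (x,y) ↦ K(x,y) − c² g(x) g(y) is positive semidefinite on ℝ for some c > 0 and g(x) = p(x) for all x ∈ Ω. -/
theorem IsPSDKernel.sum_nonneg {X : Type*} {K : X → X → ℝ} (hK : IsPSDKernel K)
    (s : Finset X) (a : X → ℝ) : 0 ≤ ∑ x ∈ s, ∑ y ∈ s, a x * a y * K x y := by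
  have h := hK s.card (fun i => a (s.equivFin.symm i)) (fun i => s.equivFin.symm i)
  have inner_sum (x : X) : ∑ i : Fin s.card,
      a x * a (s.equivFin.symm i) * K x (s.equivFin.symm i) = ∑ y ∈ s, a x * a y * K x y := by
    rw [s.equivFin.symm.sum_comp (fun y : s => a x * a y * K x y),
      Finset.sum_coe_sort s (fun y => a x * a y * K x y)]
  simp only [inner_sum] at h
  rwa [s.equivFin.symm.sum_comp (fun x : s => ∑ y ∈ s, a x * a y * K x y),
    Finset.sum_coe_sort s (fun x => ∑ y ∈ s, a x * a y * K x y)] at h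

/-- If `⟪Φ u, Φ v⟫ - c² g u g v` is a positive-semidefinite kernel with `c > 0`, then `g` is
represented by a vector of the feature space. -/
theorem IsPSDKernel.exists_eq_inner {X H : Type*} [NormedAddCommGroup H] [InnerProductSpace ℝ H]
    [CompleteSpace H] (Φ : X → H) (g : X → ℝ) {c : ℝ} (hc : 0 < c)
    (h : IsPSDKernel (fun u v => inner ℝ (Φ u) (Φ v) - c ^ 2 * g u * g v)) :
    ∃ w : H, ∀ x, g x = inner ℝ w (Φ x) := by
  set T : (X →₀ ℝ) →ₗ[ℝ] H := Finsupp.linearCombination ℝ Φ with hT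
  set S : (X →₀ ℝ) →ₗ[ℝ] ℝ := Finsupp.linearCombination ℝ g with hS
  have bound (a : X →₀ ℝ) : ‖S a‖ ≤ c⁻¹ * ‖T a‖ := by
    have h1 := h.sum_nonneg a.support a
    have hTa : ∑ x ∈ a.support, ∑ y ∈ a.support, a x * a y * inner ℝ (Φ x) (Φ y)
        = ‖T a‖ ^ 2 := by
      rw [← real_inner_self_eq_norm_sq, hT, Finsupp.linearCombination_apply, Finsupp.sum,
        sum_inner]
      refine Finset.sum_congr rfl fun x _ => ?_
      rw [inner_sum]
      refine Finset.sum_congr rfl fun y _ => ?_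
      rw [real_inner_smul_left, real_inner_smul_right]
      ring
    have hSa : ∑ x ∈ a.support, ∑ y ∈ a.support, a x * a y * (c ^ 2 * g x * g y)
        = (c * S a) ^ 2 := by
      rw [hS, Finsupp.linearCombination_apply, Finsupp.sum, mul_pow, sq (∑ x ∈ _, _),
        Finset.sum_mul_sum, Finset.mul_sum]
      refine Finset.sum_congr rfl fun x _ => ?_
      rw [Finset.mul_sum]
      refine Finset.sum_congr rfl fun y _ => ?_
      simp only [smul_eq_mul]
      ring
    simp only [mul_sub, Finset.sum_sub_distrib] at h1
    rw [hTa, hSa, sub_nonneg] at h1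
    have h2 := abs_le_of_sq_le_sq h1 (norm_nonneg _)
    rw [inv_mul_eq_div, le_div_iff₀' hc, Real.norm_eq_abs]
    calc c * |S a| = |c * S a| := by rw [abs_mul, abs_of_pos hc]
      _ ≤ ‖T a‖ := h2
  obtain ⟨L, hL⟩ : S ∈ LinearMap.range T.dualMap := by
    rw [LinearMap.range_dualMap_eq_dualAnnihilator_ker, Submodule.mem_dualAnnihilator]
    intro a ha
    have := bound a
    rw [LinearMap.mem_ker.1 ha, norm_zero, mul_zero] at this
    exact norm_le_zero_iff.1 this
  have hLT (a : X →₀ ℝ) : L (T a) = S a := LinearMap.congr_fun hL a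
  obtain ⟨F, hF, -⟩ := exists_extension_norm_eq (LinearMap.range T)
    ((L.domRestrict (LinearMap.range T)).mkContinuous c⁻¹ (by
      rintro ⟨_, a, rfl⟩
      simpa [hLT] using bound a))
  refine ⟨(InnerProductSpace.toDual ℝ H).symm F, fun x => ?_⟩
  have hTx : T (Finsupp.single x 1) = Φ x := by simp [hT]
  have hFx : F (T (Finsupp.single x 1)) = S (Finsupp.single x 1) :=
    (hF ⟨T (Finsupp.single x 1), LinearMap.mem_range_self _ _⟩).trans (hLT _)
  rw [InnerProductSpace.toDual_symm_apply, ← hTx, hFx]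
  simp [hS]

theorem hasSum_gaussianFeature (x y : ℝ) :
    HasSum (fun n : ℕ => (Real.exp (-x ^ 2) * (√(2 ^ n / n.factorial) * x ^ n)) *
      (Real.exp (-y ^ 2) * (√(2 ^ n / n.factorial) * y ^ n))) (Real.exp (-(x - y) ^ 2)) := by
  have h := (NormedSpace.expSeries_div_hasSum_exp (2 * x * y)).mul_left
    (Real.exp (-x ^ 2) * Real.exp (-y ^ 2))
  rw [← Real.exp_eq_exp_ℝ, ← Real.exp_add, ← Real.exp_add] at h
  have hxy : -x ^ 2 + -y ^ 2 + 2 * x * y = -(x - y) ^ 2 := by ring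
  rw [hxy] at h
  refine h.congr_fun fun n => ?_
  have hs : √(2 ^ n / (n.factorial : ℝ)) * √(2 ^ n / (n.factorial : ℝ))
      = 2 ^ n / n.factorial := Real.mul_self_sqrt (by positivity)
  calc _ = Real.exp (-x ^ 2) * Real.exp (-y ^ 2) *
        (√(2 ^ n / (n.factorial : ℝ)) * √(2 ^ n / (n.factorial : ℝ))) * (x ^ n * y ^ n) := by
          ring
    _ = _ := by rw [hs, ← Real.exp_add, mul_pow, mul_pow]; ring

/-- The Taylor feature map of the Gaussian kernel. -/
noncomputable def gaussianFeature (x : ℝ) : lp (fun _ : ℕ => ℝ) 2 :=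
  ⟨fun n => Real.exp (-x ^ 2) * (√(2 ^ n / n.factorial) * x ^ n), memℓp_gen <| by
    simpa only [ENNReal.toReal_ofNat, Real.rpow_two, Real.norm_eq_abs, sq_abs, ← sq]
      using (hasSum_gaussianFeature x x).summable⟩

theorem inner_gaussianFeature (x y : ℝ) :
    inner ℝ (gaussianFeature x) (gaussianFeature y) = Real.exp (-(x - y) ^ 2) := by
  refine (lp.hasSum_inner (𝕜 := ℝ) (gaussianFeature x) (gaussianFeature y)).unique ?_
  simpa [gaussianFeature, mul_comm] using hasSum_gaussianFeature x y

theorem analyticOnNhd_of_hasSum {a : ℕ → ℝ} {F : ℝ → ℝ}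
    (h : ∀ x, HasSum (fun n => a n * x ^ n) (F x)) : AnalyticOnNhd ℝ F Set.univ := by
  have hr : (FormalMultilinearSeries.ofScalars ℝ a).radius = ⊤ := by
    refine FormalMultilinearSeries.radius_eq_top_of_summable_norm _ fun r => ?_
    simpa [FormalMultilinearSeries.ofScalars_norm, abs_mul] using (h r).summable.abs
  have hF : (FormalMultilinearSeries.ofScalars ℝ a).sum = F := by
    funext x
    exact (FormalMultilinearSeries.ofScalars_sum_eq a x).trans (h x).tsum_eq
  have := (FormalMultilinearSeries.ofScalars ℝ a).hasFPowerSeriesOnBall (by simp [hr])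
  rw [hF, hr] at this
  intro x _
  exact this.analyticOnNhd x (by simp)

theorem analyticOnNhd_inner_gaussianFeature (w : lp (fun _ : ℕ => ℝ) 2) :
    AnalyticOnNhd ℝ (fun x => inner ℝ w (gaussianFeature x)) Set.univ := by
  have h (x : ℝ) : HasSum (fun n => (w n * √(2 ^ n / n.factorial)) * x ^ n)
      (Real.exp (x ^ 2) * inner ℝ w (gaussianFeature x)) := by
    refine ((lp.hasSum_inner (𝕜 := ℝ) w (gaussianFeature x)).mul_left
      (Real.exp (x ^ 2))).congr_fun fun n => ?_
    have he : Real.exp (x ^ 2) * Real.exp (-x ^ 2) = 1 := by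
      rw [← Real.exp_add]; simp
    simp only [gaussianFeature, RCLike.inner_apply, conj_trivial]
    linear_combination (-(w n * √(2 ^ n / n.factorial) * x ^ n)) * he
  have hexp : AnalyticOnNhd ℝ (fun x : ℝ => Real.exp (-x ^ 2)) Set.univ :=
    fun x _ => by fun_prop
  refine (hexp.mul (analyticOnNhd_of_hasSum h)).congr isOpen_univ fun x _ => ?_
  rw [← mul_assoc, ← Real.exp_add]
  simp

/-- A nonzero constant is not in the RKHS of the Gaussian kernel on `ℝ`: testing on `N` points
at mutual distance tending to infinity gives `(N d)² ≤ N`. -/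
theorem eq_zero_of_isPSDKernel_gaussian_sub_const {d : ℝ}
    (h : IsPSDKernel (fun u v : ℝ => Real.exp (-(u - v) ^ 2) - d ^ 2)) : d = 0 := by
  have key (N : ℕ) : (N : ℝ) ^ 2 * d ^ 2 ≤ N := by
    have hlim : Filter.Tendsto
        (fun t : ℝ => ∑ n : Fin N, ∑ m : Fin N, Real.exp (-(t * n - t * m) ^ 2))
        Filter.atTop (nhds (∑ n : Fin N, ∑ m : Fin N, if n = m then 1 else 0)) := by
      refine tendsto_finsetSum _ fun n _ => tendsto_finsetSum _ fun m _ => ?_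
      split_ifs with hnm
      · simp [hnm]
      · have hpos : 0 < ((n : ℝ) - m) ^ 2 := by
          have : (n : ℝ) - m ≠ 0 := sub_ne_zero.2 fun e => hnm (Fin.ext (by exact_mod_cast e))
          positivity
        have := Real.tendsto_exp_neg_atTop_nhds_zero.comp
          ((Filter.tendsto_pow_atTop (two_ne_zero)).atTop_mul_const hpos)
        refine this.congr fun t => ?_
        simp only [Function.comp_apply]
        congr 2
        ring
    have hle := ge_of_tendsto' hlim (b := (N : ℝ) ^ 2 * d ^ 2) fun t => by
      have := h N (fun _ => 1) (fun n => t * n)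
      simp only [mul_sub, Finset.sum_sub_distrib, mul_one, one_mul, Finset.sum_const,
        Finset.card_univ, Fintype.card_fin, nsmul_eq_mul] at this
      linarith
    simpa using hle
  by_contra hd
  have hd2 : 0 < d ^ 2 := by positivity
  obtain ⟨N, hN⟩ := exists_nat_gt (1 / d ^ 2)
  rw [div_lt_iff₀ hd2] at hN
  have hN0 : 0 < (N : ℝ) := by
    by_contra h0
    nlinarith
  nlinarith [key N]

/-- For the Gaussian kernel `K(x,y) = exp(-(x-y)²)` on `ℝ`, a set
`Ω ⊆ ℝ` with an accumulation point and a nonzero polynomial `p`, the restriction `p|_Ω`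
is not in `H_K(Ω)`: there is no `g : ℝ → ℝ` such that `(x,y) ↦ K(x,y) - c² g(x) g(y)` is
positive semidefinite on `ℝ` for some `c > 0` and `g = p` on `Ω`. -/
theorem stmt10_gaussian_no_polynomials
    (K : ℝ → ℝ → ℝ) (hK : ∀ x y : ℝ, K x y = Real.exp (-(x - y) ^ 2))
    (Ω : Set ℝ) (hΩ : ∃ q : ℝ, AccPt q (Filter.principal Ω))
    (p : Polynomial ℝ) (hp : p ≠ 0) :
    ¬ ∃ g : ℝ → ℝ, (∃ c : ℝ, 0 < c ∧
        IsPSDKernel (fun u v : ℝ => K u v - c ^ 2 * g u * g v)) ∧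
      ∀ x ∈ Ω, g x = p.eval x := by
  rintro ⟨g, ⟨c, hc, hpsd⟩, hgp⟩
  obtain ⟨q, hq⟩ := hΩ
  simp only [hK] at hpsd
  obtain ⟨w, hw⟩ := IsPSDKernel.exists_eq_inner gaussianFeature g hc
    (by simpa only [inner_gaussianFeature] using hpsd)
  have hg : AnalyticOnNhd ℝ g Set.univ := by
    rw [funext hw]
    exact analyticOnNhd_inner_gaussianFeature w
  have hgp' : g = fun x => p.eval x :=
    hg.eq_of_frequently_eq (AnalyticOnNhd.eval_polynomial p)
      ((accPt_iff_frequently_nhdsNE.1 hq).mono hgp)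
  subst hgp'
  have hbound (x : ℝ) : |p.eval x| ≤ c⁻¹ := by
    have := hpsd 1 (fun _ => 1) (fun _ => x)
    simp at this
    refine abs_le_of_sq_le_sq' ?_ (by positivity) |> abs_le.2
    rw [inv_pow, ← one_div, le_div_iff₀' (by positivity)]
    linarith
  have hdeg : p.degree ≤ 0 := (Polynomial.isBoundedUnder_abs_atTop_iff p).1
    (Filter.isBoundedUnder_of ⟨c⁻¹, hbound⟩)
  obtain ⟨d, rfl⟩ : ∃ d, p = Polynomial.C d := ⟨_, Polynomial.eq_C_of_degree_le_zero hdeg⟩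
  have hcd : c * d = 0 := eq_zero_of_isPSDKernel_gaussian_sub_const (by
    convert hpsd using 3
    simp
    ring)
  rcases mul_eq_zero.1 hcd with h | h
  · exact hc.ne' h
  · exact hp (by simp [h])
end

section
/- Let f : ℝ → ℝ be defined by f(x) = sin(π(x + 1/2))². Let φ : [0,∞) → ℝ satisfy φ ≥ 0 and lim_{r→∞} φ(r) = 0, and suppose K(x,y) = φ((x−y)²) defines a positive-semidefinite kernel on ℝ. Then f ∉ H_K(ℝ): for every c > 0 the function (x,y) ↦ K(x,y) − c² f(x) f(y) is not positive semidefinite on ℝ. (Indeed, for the sequence x_n = n(n+1)/2 one has f(x_n) = 1 for all n, while K(x_{ℓ+n}, x_{ℓ+m}) → 0 as ℓ → ∞ for n ≠ m.) -/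
/-- The function `sin(π(x + 1/2))²` equals `1` at every natural number. -/
lemma sin_pi_mul_natCast_add_half_sq (k : ℕ) :
    Real.sin (Real.pi * ((k : ℝ) + 1 / 2)) ^ 2 = 1 := by
  have h : Real.pi * ((k : ℝ) + 1 / 2) = k * Real.pi + Real.pi / 2 := by ring
  rw [h, Real.sin_add_pi_div_two, Real.cos_nat_mul_pi, ← pow_mul, mul_comm, pow_mul]
  simp

/-- A kernel that, along a sequence, is at most `-ε < 0` off the diagonal and bounded above on
the diagonal is not positive semidefinite. -/
lemma not_isPSDKernel_of_le {Ω : Type*} (K : Ω → Ω → ℝ) (x : ℕ → Ω) (B ε : ℝ) (hε : 0 < ε)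
    (h : ∀ n m : ℕ, K (x n) (x m) ≤ (if n = m then B else 0) - ε) : ¬ IsPSDKernel K := by
  intro hK
  obtain ⟨N, hN⟩ := exists_nat_gt (max 0 (B / ε))
  have hN0 : (0 : ℝ) < N := (le_max_left _ _).trans_lt hN
  have hNB : B < N * ε := (div_lt_iff₀ hε).1 ((le_max_right _ _).trans_lt hN)
  have hle : ∑ n : Fin N, ∑ m : Fin N, (1 : ℝ) * 1 * K (x n) (x m) ≤
      ∑ n : Fin N, ∑ m : Fin N, ((if n = m then B else 0) - ε) := by
    refine Finset.sum_le_sum fun n _ => Finset.sum_le_sum fun m _ => ?_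
    simpa [Fin.ext_iff] using h n m
  have hsum : ∑ n : Fin N, ∑ m : Fin N, ((if n = m then B else 0) - ε) = N * (B - N * ε) := by
    simp [Finset.sum_sub_distrib]
    ring
  have hpos := hK N (fun _ => 1) (fun n => x n)
  have hneg : (N : ℝ) * (B - N * ε) < 0 := mul_neg_of_pos_of_neg hN0 (by linarith)
  linarith

/-- The function `f(x) = sin(π(x + 1/2))²` is not in the RKHS of any
translation-invariant kernel `K(x,y) = φ((x-y)²)` with `φ ≥ 0` decaying to zero at
infinity: for every `c > 0` the function `(x,y) ↦ K(x,y) - c² f(x) f(y)` is not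
positive semidefinite on `ℝ`. -/
theorem stmt13_sine_squared_not_in_rkhs
    (f : ℝ → ℝ)
    (hf : ∀ x : ℝ, f x = (Real.sin (Real.pi * (x + 1 / 2))) ^ 2)
    (φ : ℝ → ℝ) (hφ_nonneg : ∀ r : ℝ, 0 ≤ r → 0 ≤ φ r)
    (hφ_decay : Filter.Tendsto φ Filter.atTop (nhds 0))
    (K : ℝ → ℝ → ℝ) (hK : ∀ x y : ℝ, K x y = φ ((x - y) ^ 2))
    (hPSD : IsPSDKernel K) :
    ∀ c : ℝ, 0 < c →
      ¬ IsPSDKernel (fun p q : ℝ => K p q - c ^ 2 * f p * f q) := by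
  intro c hc
  have hc2 : 0 < c ^ 2 / 2 := by positivity
  obtain ⟨R, hR⟩ := Filter.eventually_atTop.1 (hφ_decay.eventually_lt_const hc2)
  obtain ⟨D, hD⟩ := exists_nat_gt (max 1 R)
  have hD1 : (1 : ℝ) < D := (le_max_left _ _).trans_lt hD
  have hDR : R < D := (le_max_right _ _).trans_lt hD
  refine not_isPSDKernel_of_le _ (fun n => ((D * n : ℕ) : ℝ)) (φ 0) (c ^ 2 / 2) hc2 fun n m => ?_
  simp only [hf, sin_pi_mul_natCast_add_half_sq, hK, mul_one]
  split_ifs with hnm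
  · subst hnm
    simp only [sub_self, ne_eq, OfNat.ofNat_ne_zero, not_false_eq_true, zero_pow]
    linarith
  · have hgap : (1 : ℝ) ≤ ((n : ℝ) - m) ^ 2 := by
      have hz : (n : ℤ) - m ≠ 0 := by omega
      have h1 : (1 : ℤ) ≤ ((n : ℤ) - m) ^ 2 := by
        have := sq_pos_of_ne_zero hz
        omega
      exact_mod_cast h1
    have hfar : R ≤ (((D * n : ℕ) : ℝ) - ((D * m : ℕ) : ℝ)) ^ 2 := by
      push_cast
      nlinarith [mul_le_mul_of_nonneg_left hgap (sq_nonneg (D : ℝ))]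
    linarith [hR _ hfar]
end

section
/- Let φ : [0,∞) → ℝ satisfy φ ≥ 0 and lim_{r→∞} φ(r) = 0, and suppose K(x,y) = φ((x−y)²) defines a positive-semidefinite kernel on ℝ. Then for every real number b ≠ 0 the constant function f(x) = b is not an element of H_K(ℝ): for every c > 0 the function (x,y) ↦ K(x,y) − c² b² is not positive semidefinite on ℝ. -/
/-- If `φ ≥ 0` on `[0,∞)` decays to zero at infinity and
`K(x,y) = φ((x-y)²)` is a PSD kernel on `ℝ`, then for every `b ≠ 0` the constant
function `f(x) = b` is not in `H_K(ℝ)`: for every `c > 0` the function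
`(x,y) ↦ K(x,y) - c² b²` is not positive semidefinite on `ℝ`. -/
theorem stmt14_constants_not_in_rkhs
    (φ : ℝ → ℝ) (hφ_nonneg : ∀ r : ℝ, 0 ≤ r → 0 ≤ φ r)
    (hφ_decay : Filter.Tendsto φ Filter.atTop (nhds 0))
    (K : ℝ → ℝ → ℝ) (hK : ∀ x y : ℝ, K x y = φ ((x - y) ^ 2))
    (hPSD : IsPSDKernel K)
    (b : ℝ) (hb : b ≠ 0) :
    ∀ c : ℝ, 0 < c →
      ¬ IsPSDKernel (fun p q : ℝ => K p q - c ^ 2 * b ^ 2) := by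
  intro c hc h
  have he : 0 < c ^ 2 * b ^ 2 := by positivity
  set e := c ^ 2 * b ^ 2
  obtain ⟨R₀, hR₀⟩ := Filter.eventually_atTop.1 (hφ_decay.eventually_le_const (half_pos he))
  obtain ⟨R, hRR₀, hR1⟩ : ∃ R : ℝ, R₀ ≤ R ∧ 1 ≤ R := ⟨max R₀ 1, le_max_left _ _, le_max_right _ _⟩
  obtain ⟨N, hN⟩ := exists_nat_gt (φ 0 / (e / 2))
  have hNe : φ 0 < N * (e / 2) := (div_lt_iff₀ (half_pos he)).1 hN
  have hN0 : (0 : ℝ) < N := lt_of_le_of_lt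
    (div_nonneg (hφ_nonneg 0 le_rfl) (half_pos he).le) hN
  have hterm : ∀ n m : Fin N,
      K (n * R) (m * R) - e ≤ (if n = m then φ 0 else 0) - e / 2 := by
    intro n m
    rw [hK]
    split_ifs with hnm
    · subst hnm
      simp only [sub_self, ne_eq, OfNat.ofNat_ne_zero, not_false_eq_true, zero_pow]
      linarith
    · have hsep : (1 : ℝ) ≤ ((n : ℝ) - m) ^ 2 := by
        have hne : ((n : ℤ) - m) ≠ 0 := by omega
        have hpos : (0 : ℤ) < ((n : ℤ) - m) ^ 2 := by positivity
        exact_mod_cast Int.add_one_le_iff.2 hpos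
      have hfar : R₀ ≤ ((n : ℝ) * R - m * R) ^ 2 := by
        rw [← sub_mul, mul_pow]
        nlinarith [mul_le_mul_of_nonneg_right hsep (sq_nonneg R)]
      linarith [hR₀ _ hfar]
  have hsum := (h N (fun _ => 1) (fun n => n * R)).trans
    (Finset.sum_le_sum fun n _ => Finset.sum_le_sum fun m _ => by
      simpa only [one_mul] using hterm n m)
  simp only [Finset.sum_sub_distrib, Finset.sum_ite_eq, Finset.mem_univ, if_true,
    Finset.sum_const, Finset.card_univ, Fintype.card_fin, nsmul_eq_mul] at hsum
  nlinarith [mul_lt_mul_of_pos_left hNe hN0]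
end
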